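/- arXiv:2004.04599 — 9 statements merged into one kernel-verified Lean document; each statement's English description precedes it below -/
import Mathlib

section
/- Let λ = (L_i)_{i∈I} and μ = (M_j)_{j∈J} be weak partitions of N. Then G_λ ∩ G_μ = G_{λ∧μ}, where λ∧μ is the weak partition indexed by I × J with blocks L_i ∩ M_j; that is, an element (w, f) of G_N satisfies (w ∈ S_λ, supp f ⊆ Y_λ, w ∈ S_μ, supp f ⊆ Y_μ) if and only if w preserves every block L_i ∩ M_j and supp f ⊆ ⋃_{(i,j)} Y_{L_i ∩ M_j}. -/
open scoped Pointwise

/-- A Young structure on a finite type `N`: a finite type `Y` with an action of `Equiv.Perm N`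
together with an assignment of a subset `Y_K ⊆ Y` to each subset `K ⊆ N`, satisfying
`Y_∅ = ∅`, `Y_N = Y`, `Y_K ∩ Y_L = Y_{K ∩ L}` and `w • Y_K = Y_{w K}`. -/
structure YoungStructure (N : Type) (Y : Type) [Fintype N] [Fintype Y]
    [MulAction (Equiv.Perm N) Y] where
  sub : Set N → Set Y
  sub_empty : sub (∅ : Set N) = (∅ : Set Y)
  sub_univ : sub (Set.univ : Set N) = (Set.univ : Set Y)
  inter_sub : ∀ K L : Set N, sub K ∩ sub L = sub (K ∩ L)
  smul_sub : ∀ (w : Equiv.Perm N) (K : Set N), w • sub K = sub (w • K)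

/-- A weak partition of `N` indexed by a finite type `I`: a family of pairwise disjoint
subsets of `N` whose union is `N` (blocks may be empty). -/
structure WeakPartition (N : Type) (I : Type) [Fintype I] where
  blocks : I → Set N
  disjoint : ∀ i j : I, i ≠ j → Disjoint (blocks i) (blocks j)
  iUnion_blocks : (⋃ i, blocks i) = (Set.univ : Set N)

/-- `lam ≤ mu`: each block of `mu` is a union of blocks of `lam`. -/
def WeakPartition.Refines {N I J : Type} [Fintype I] [Fintype J]
    (lam : WeakPartition N I) (mu : WeakPartition N J) : Prop :=
  ∀ j : J, ∃ s : Set I, mu.blocks j = ⋃ i ∈ s, lam.blocks i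

/-- The subset `Y_λ = ⋃ i, Y_{L_i}` of `Y`. -/
def YoungStructure.ypart {N Y : Type} [Fintype N] [Fintype Y] [MulAction (Equiv.Perm N) Y]
    (ys : YoungStructure N Y) {I : Type} [Fintype I] (lam : WeakPartition N I) : Set Y :=
  ⋃ i, ys.sub (lam.blocks i)

/-- The action of `Equiv.Perm N` on `Map(Y,H)` by `(w • f) y = f (w⁻¹ • y)`,
as a homomorphism into `MulAut (Y → H)`. -/
def wreathAut (N Y H : Type) [Fintype N] [Fintype Y] [MulAction (Equiv.Perm N) Y] [Group H] :
    Equiv.Perm N →* MulAut (Y → H) where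
  toFun w :=
    { toFun := fun f y => f (w⁻¹ • y)
      invFun := fun f y => f (w • y)
      left_inv := fun f => funext fun y => by
        show f (w⁻¹ • w • y) = f y; rw [inv_smul_smul]
      right_inv := fun f => funext fun y => by
        show f (w • w⁻¹ • y) = f y; rw [smul_inv_smul]
      map_mul' := fun f g => rfl }
  map_one' := MulEquiv.ext fun f => funext fun y => by simp
  map_mul' := fun u v => MulEquiv.ext fun f => funext fun y => by
    show f ((u * v)⁻¹ • y) = f (v⁻¹ • u⁻¹ • y)
    rw [mul_inv_rev, mul_smul]

/-- The wreath product `G_N = S_N ⋉ Map(Y,H)`. -/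
abbrev WreathProduct (N Y H : Type) [Fintype N] [Fintype Y] [MulAction (Equiv.Perm N) Y]
    [Group H] : Type :=
  SemidirectProduct (Y → H) (Equiv.Perm N) (wreathAut N Y H)

section Subsets

variable {N Y H : Type} [Fintype N] [Fintype Y] [MulAction (Equiv.Perm N) Y] [Group H]

/-- The subgroup (as a set) `G_λ = {(w,f) | w ∈ S_λ, supp f ⊆ Y_λ}` of `G_N`. -/
def YoungStructure.Gset (ys : YoungStructure N Y) {I : Type} [Fintype I]
    (lam : WeakPartition N I) : Set (WreathProduct N Y H) :=
  {g | (∀ i, g.right • lam.blocks i = lam.blocks i) ∧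
    Function.mulSupport g.left ⊆ ys.ypart lam}

/-- The set `P_λ^μ = {(w,f) | w ∈ S_λ, supp f ⊆ Y_μ}`. -/
def YoungStructure.Pset (ys : YoungStructure N Y) {I J : Type} [Fintype I] [Fintype J]
    (lam : WeakPartition N I) (mu : WeakPartition N J) : Set (WreathProduct N Y H) :=
  {g | (∀ i, g.right • lam.blocks i = lam.blocks i) ∧
    Function.mulSupport g.left ⊆ ys.ypart mu}

/-- The set `U_λ^μ = {(1,f) | supp f ⊆ Y_μ \ Y_λ}`. -/
def YoungStructure.Uset (ys : YoungStructure N Y) {I J : Type} [Fintype I] [Fintype J]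
    (lam : WeakPartition N I) (mu : WeakPartition N J) : Set (WreathProduct N Y H) :=
  {g | g.right = 1 ∧ Function.mulSupport g.left ⊆ ys.ypart mu \ ys.ypart lam}

end Subsets

/-- The meet `λ ∧ μ`, the weak partition indexed by `I × J` with blocks `L_i ∩ M_j`. -/
def WeakPartition.meet {N I J : Type} [Fintype I] [Fintype J]
    (lam : WeakPartition N I) (mu : WeakPartition N J) : WeakPartition N (I × J) where
  blocks p := lam.blocks p.1 ∩ mu.blocks p.2
  disjoint := by
    rintro ⟨i, j⟩ ⟨i', j'⟩ h
    rcases Prod.mk.injEq .. ▸ (fun hh => h (Prod.ext (hh.1) (hh.2)) : ¬(i = i' ∧ j = j')) with _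
    by_cases hi : i = i'
    · have hj : j ≠ j' := fun hj => h (by simp [hi, hj])
      exact ((mu.disjoint j j' hj).mono Set.inter_subset_right Set.inter_subset_right)
    · exact ((lam.disjoint i i' hi).mono Set.inter_subset_left Set.inter_subset_left)
  iUnion_blocks := by
    apply Set.eq_univ_of_forall
    intro x
    have h1 : x ∈ ⋃ i, lam.blocks i := lam.iUnion_blocks ▸ Set.mem_univ x
    have h2 : x ∈ ⋃ j, mu.blocks j := mu.iUnion_blocks ▸ Set.mem_univ x
    rcases Set.mem_iUnion.1 h1 with ⟨i, hi⟩
    rcases Set.mem_iUnion.1 h2 with ⟨j, hj⟩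
    exact Set.mem_iUnion.2 ⟨(i, j), hi, hj⟩

/-- The weak partition `wλ` with blocks `w (L_i)`. -/
def WeakPartition.smulWP {N I : Type} [Fintype I] (w : Equiv.Perm N)
    (lam : WeakPartition N I) : WeakPartition N I where
  blocks i := w • lam.blocks i
  disjoint i j h := Set.disjoint_smul_set.2 (lam.disjoint i j h)
  iUnion_blocks := by rw [← Set.smul_set_iUnion, lam.iUnion_blocks, Set.smul_set_univ]

/-- The one-block weak partition of `N`. -/
def WeakPartition.full (N : Type) : WeakPartition N PUnit where
  blocks _ := Set.univ
  disjoint i j h := absurd (Subsingleton.elim i j) h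
  iUnion_blocks := Set.iUnion_const Set.univ

/-- `G_λ ∩ G_μ = G_{λ∧μ}`, elementwise. -/
theorem statement1 {N Y H I J : Type} [Fintype N] [Fintype Y] [MulAction (Equiv.Perm N) Y]
    [Group H] [Fintype H] [Fintype I] [Fintype J]
    (ys : YoungStructure N Y) (lam : WeakPartition N I) (mu : WeakPartition N J) :
    ∀ g : WreathProduct N Y H,
      ((∀ i, g.right • lam.blocks i = lam.blocks i) ∧
        Function.mulSupport g.left ⊆ ys.ypart lam ∧
        (∀ j, g.right • mu.blocks j = mu.blocks j) ∧
        Function.mulSupport g.left ⊆ ys.ypart mu) ↔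
      ((∀ p : I × J, g.right • (lam.blocks p.1 ∩ mu.blocks p.2) =
          lam.blocks p.1 ∩ mu.blocks p.2) ∧
        Function.mulSupport g.left ⊆
          ⋃ p : I × J, ys.sub (lam.blocks p.1 ∩ mu.blocks p.2)) := by
  intro g
  have hl : ∀ i, lam.blocks i = ⋃ j, lam.blocks i ∩ mu.blocks j := fun i => by
    rw [← Set.inter_iUnion, mu.iUnion_blocks, Set.inter_univ]
  have hm : ∀ j, mu.blocks j = ⋃ i, lam.blocks i ∩ mu.blocks j := fun j => by
    rw [← Set.iUnion_inter, lam.iUnion_blocks, Set.univ_inter]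
  constructor
  · rintro ⟨h1, h2, h3, h4⟩
    refine ⟨fun p => ?_, fun y hy => ?_⟩
    · rw [Set.smul_set_inter, h1, h3]
    · obtain ⟨i, hi⟩ := Set.mem_iUnion.1 (h2 hy)
      obtain ⟨j, hj⟩ := Set.mem_iUnion.1 (h4 hy)
      refine Set.mem_iUnion.2 ⟨(i, j), ?_⟩
      rw [← ys.inter_sub]
      exact ⟨hi, hj⟩
  · rintro ⟨h1, h2⟩
    refine ⟨fun i => ?_, fun y hy => ?_, fun j => ?_, fun y hy => ?_⟩
    · rw [hl i, Set.smul_set_iUnion]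
      exact Set.iUnion_congr fun j => h1 (i, j)
    · obtain ⟨p, hp⟩ := Set.mem_iUnion.1 (h2 hy)
      rw [← ys.inter_sub] at hp
      exact Set.mem_iUnion.2 ⟨p.1, hp.1⟩
    · rw [hm j, Set.smul_set_iUnion]
      exact Set.iUnion_congr fun i => h1 (i, j)
    · obtain ⟨p, hp⟩ := Set.mem_iUnion.1 (h2 hy)
      rw [← ys.inter_sub] at hp
      exact Set.mem_iUnion.2 ⟨p.2, hp.2⟩
end

section
/- Let λ ≤ μ be weak partitions of N. Then the subgroup U_λ^μ of G_N is normalised by G_λ, the intersection G_λ ∩ U_λ^μ is trivial, and the multiplication map G_λ × U_λ^μ → P_λ^μ, (g, u) ↦ g·u, is a bijection; thus P_λ^μ is the internal semidirect product G_λ ⋉ U_λ^μ. -/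
open scoped Pointwise

section Helpers

variable {N Y H I J : Type} [Fintype N] [Fintype Y] [MulAction (Equiv.Perm N) Y] [Group H]
  [Fintype I] [Fintype J]

theorem ypart_smul_mem (ys : YoungStructure N Y) (lam : WeakPartition N I) (w : Equiv.Perm N)
    (hw : ∀ i, w • lam.blocks i = lam.blocks i) (y : Y) :
    w • y ∈ ys.ypart lam ↔ y ∈ ys.ypart lam := by
  simp only [YoungStructure.ypart, Set.mem_iUnion]
  refine exists_congr fun i => ?_
  conv_lhs => rw [← hw i, ← ys.smul_sub]
  exact Set.smul_mem_smul_set_iff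

theorem ypart_inv_smul_mem (ys : YoungStructure N Y) (lam : WeakPartition N I) (w : Equiv.Perm N)
    (hw : ∀ i, w • lam.blocks i = lam.blocks i) (y : Y) :
    w⁻¹ • y ∈ ys.ypart lam ↔ y ∈ ys.ypart lam := by
  rw [← ypart_smul_mem ys lam w hw, smul_inv_smul]

theorem refines_stab (lam : WeakPartition N I) (mu : WeakPartition N J) (hle : lam.Refines mu)
    (w : Equiv.Perm N) (hw : ∀ i, w • lam.blocks i = lam.blocks i) (j : J) :
    w • mu.blocks j = mu.blocks j := by
  obtain ⟨s, hs⟩ := hle j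
  rw [hs]
  simp only [Set.smul_set_iUnion, hw]

theorem ypart_mono (ys : YoungStructure N Y) (lam : WeakPartition N I) (mu : WeakPartition N J)
    (hle : lam.Refines mu) : ys.ypart lam ⊆ ys.ypart mu := by
  intro y hy
  simp only [YoungStructure.ypart, Set.mem_iUnion] at hy ⊢
  obtain ⟨i, hi⟩ := hy
  rcases (lam.blocks i).eq_empty_or_nonempty with h | ⟨x, hx⟩
  · rw [h, ys.sub_empty] at hi
    exact hi.elim
  · have h2 : x ∈ ⋃ j, mu.blocks j := mu.iUnion_blocks ▸ Set.mem_univ x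
    obtain ⟨j, hj⟩ := Set.mem_iUnion.1 h2
    refine ⟨j, ?_⟩
    obtain ⟨s, hs⟩ := hle j
    rw [hs] at hj
    simp only [Set.mem_iUnion] at hj
    obtain ⟨i', hi', hx'⟩ := hj
    have e : i = i' := by
      by_contra hne
      exact Set.disjoint_left.1 (lam.disjoint i i' hne) hx hx'
    subst e
    have hsub : lam.blocks i ∩ mu.blocks j = lam.blocks i := by
      rw [hs]
      exact Set.inter_eq_left.2 (Set.subset_biUnion_of_mem hi')
    rw [← hsub, ← ys.inter_sub] at hi
    exact hi.2

theorem wreath_mul_left_apply (g u : WreathProduct N Y H) (y : Y) :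
    (g * u).left y = g.left y * u.left (g.right⁻¹ • y) := rfl

theorem wreath_inv_left_apply (g : WreathProduct N Y H) (y : Y) :
    (g⁻¹).left y = (g.left (g.right • y))⁻¹ := by
  change (g.left ((g.right⁻¹)⁻¹ • y))⁻¹ = _
  rw [inv_inv]

end Helpers

/-- for `λ ≤ μ`, `U_λ^μ` is normalised by `G_λ`, `G_λ ∩ U_λ^μ` is trivial, and
multiplication `G_λ × U_λ^μ → P_λ^μ` is a bijection. -/
theorem statement3 {N Y H I J : Type} [Fintype N] [Fintype Y] [MulAction (Equiv.Perm N) Y]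
    [Group H] [Fintype H] [Fintype I] [Fintype J]
    (ys : YoungStructure N Y) (lam : WeakPartition N I) (mu : WeakPartition N J)
    (hle : lam.Refines mu) :
    (∀ g ∈ (ys.Gset lam : Set (WreathProduct N Y H)), ∀ u ∈ ys.Uset lam mu,
        g * u * g⁻¹ ∈ ys.Uset lam mu) ∧
    ((ys.Gset lam : Set (WreathProduct N Y H)) ∩ ys.Uset lam mu = {1}) ∧
    Set.BijOn (fun p : WreathProduct N Y H × WreathProduct N Y H => p.1 * p.2)
      ((ys.Gset lam : Set (WreathProduct N Y H)) ×ˢ (ys.Uset lam mu))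
      (ys.Pset lam mu) := by
  classical
  have hmono := ypart_mono ys lam mu hle
  refine ⟨?_, ?_, ?_, ?_, ?_⟩
  · rintro g ⟨hg1, hg2⟩ u ⟨hu1, hu2⟩
    have hmu := refines_stab lam mu hle g.right hg1
    refine ⟨by simp [hu1], ?_⟩
    intro y hy
    have hne : u.left (g.right⁻¹ • y) ≠ 1 := by
      intro h
      apply hy
      rw [wreath_mul_left_apply, wreath_mul_left_apply, h, wreath_inv_left_apply]
      simp [hu1]
    have := hu2 hne
    exact ⟨(ypart_inv_smul_mem ys mu _ hmu y).1 this.1,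
      fun h => this.2 ((ypart_inv_smul_mem ys lam _ hg1 y).2 h)⟩
  · ext g
    constructor
    · rintro ⟨⟨-, h2⟩, h3, h4⟩
      refine SemidirectProduct.ext (funext fun y => ?_) h3
      by_contra hne
      exact (h4 hne).2 (h2 hne)
    · rintro rfl
      refine ⟨⟨fun i => by simp, ?_⟩, rfl, ?_⟩ <;> simp
  · rintro ⟨g, u⟩ ⟨⟨hg1, hg2⟩, hu1, hu2⟩
    dsimp only at hg1 hg2 hu1 hu2
    have hmu := refines_stab lam mu hle g.right hg1
    refine ⟨fun i => by simp [hu1, hg1 i], ?_⟩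
    intro y hy
    by_contra hn
    apply hy
    change (g * u).left y = 1
    have e1 : g.left y = 1 := by
      by_contra h
      exact hn (hmono (hg2 h))
    have e2 : u.left (g.right⁻¹ • y) = 1 := by
      by_contra h
      exact hn ((ypart_inv_smul_mem ys mu _ hmu y).1 (hu2 h).1)
    rw [wreath_mul_left_apply, e1, e2, one_mul]
  · rintro ⟨g, u⟩ ⟨⟨hg1, hg2⟩, hu1, hu2⟩ ⟨g', u'⟩ ⟨⟨hg1', hg2'⟩, hu1', hu2'⟩ heq
    dsimp only at hg1 hg2 hu1 hu2 hg1' hg2' hu1' hu2' heq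
    have hr : g.right = g'.right := by
      have := congrArg SemidirectProduct.right heq
      simpa [hu1, hu1'] using this
    have hgg : g = g' := by
      refine SemidirectProduct.ext (funext fun y => ?_) hr
      by_cases hy : y ∈ ys.ypart lam
      · have e := congrFun (congrArg SemidirectProduct.left heq) y
        rw [wreath_mul_left_apply, wreath_mul_left_apply] at e
        have e1 : u.left (g.right⁻¹ • y) = 1 := by
          by_contra h
          exact (hu2 h).2 ((ypart_inv_smul_mem ys lam _ hg1 y).2 hy)
        have e2 : u'.left (g'.right⁻¹ • y) = 1 := by
          by_contra h
          exact (hu2' h).2 ((ypart_inv_smul_mem ys lam _ hg1' y).2 hy)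
        rwa [e1, e2, mul_one, mul_one] at e
      · have e1 : g.left y = 1 := by
          by_contra h
          exact hy (hg2 h)
        have e2 : g'.left y = 1 := by
          by_contra h
          exact hy (hg2' h)
        rw [e1, e2]
    subst hgg
    rw [mul_left_cancel heq]
  · rintro p ⟨hp1, hp2⟩
    have hmu := refines_stab lam mu hle p.right hp1
    refine ⟨(⟨fun y => if y ∈ ys.ypart lam then p.left y else 1, p.right⟩,
      ⟨fun y => if y ∈ ys.ypart lam then 1 else p.left (p.right • y), 1⟩),
      ⟨⟨hp1, ?_⟩, rfl, ?_⟩, ?_⟩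
    · intro y hy
      by_contra h
      exact hy (if_neg h)
    · intro y hy
      have hn : y ∉ ys.ypart lam := fun h => hy (if_pos h)
      refine ⟨(ypart_smul_mem ys mu _ hmu y).1 (hp2 fun h => hy ?_), hn⟩
      exact (if_neg hn).trans h
    · refine SemidirectProduct.ext (funext fun y => ?_) (mul_one _)
      dsimp only
      rw [wreath_mul_left_apply]
      dsimp only
      by_cases hy : y ∈ ys.ypart lam
      · rw [if_pos hy, if_pos ((ypart_inv_smul_mem ys lam _ hp1 y).2 hy), mul_one]
      · rw [if_neg hy, if_neg (fun h => hy ((ypart_inv_smul_mem ys lam _ hp1 y).1 h)), one_mul,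
          smul_inv_smul]
end

section
/- Let λ and μ be weak partitions of N, and let ν denote the one-block weak partition of N (so that λ∧μ ≤ λ ≤ ν and μ ≤ ν). Then G_λ ∩ U_μ^ν = U_{λ∧μ}^λ; that is, an element (1, f) of G_N satisfies (f has support contained in Y_λ and in Y \ Y_μ) if and only if supp f ⊆ Y_λ \ Y_{λ∧μ}. -/
open scoped Pointwise

/-- `G_λ ∩ U_μ^ν = U_{λ∧μ}^λ`, where `ν` is the one-block weak partition. -/
theorem statement5 {N Y H I J : Type} [Fintype N] [Fintype Y] [MulAction (Equiv.Perm N) Y]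
    [Group H] [Fintype H] [Fintype I] [Fintype J]
    (ys : YoungStructure N Y) (lam : WeakPartition N I) (mu : WeakPartition N J) :
    ((ys.Gset lam : Set (WreathProduct N Y H)) ∩ ys.Uset mu (WeakPartition.full N) =
      ys.Uset (lam.meet mu) lam) ∧
    ∀ f : Y → H,
      (Function.mulSupport f ⊆ ys.ypart lam ∧
        Function.mulSupport f ⊆ (Set.univ : Set Y) \ ys.ypart mu) ↔
      Function.mulSupport f ⊆ ys.ypart lam \ ys.ypart (lam.meet mu) := by
  have hmeet : ys.ypart (lam.meet mu) = ys.ypart lam ∩ ys.ypart mu := by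
    ext y
    simp only [YoungStructure.ypart, WeakPartition.meet, ← ys.inter_sub, Set.mem_iUnion,
      Set.mem_inter_iff, Prod.exists]
    constructor
    · rintro ⟨i, j, hi, hj⟩
      exact ⟨⟨i, hi⟩, ⟨j, hj⟩⟩
    · rintro ⟨⟨i, hi⟩, ⟨j, hj⟩⟩
      exact ⟨i, j, hi, hj⟩
  have hfull : ys.ypart (WeakPartition.full N) = Set.univ := by
    simp [YoungStructure.ypart, WeakPartition.full, ys.sub_univ, Set.iUnion_const]
  have key : ∀ f : Y → H,
      (Function.mulSupport f ⊆ ys.ypart lam ∧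
        Function.mulSupport f ⊆ (Set.univ : Set Y) \ ys.ypart mu) ↔
      Function.mulSupport f ⊆ ys.ypart lam \ ys.ypart (lam.meet mu) := by
    intro f
    rw [hmeet, ← Set.subset_inter_iff]
    have : ys.ypart lam ∩ (Set.univ \ ys.ypart mu) =
        ys.ypart lam \ (ys.ypart lam ∩ ys.ypart mu) := by
      ext y
      simp only [Set.mem_inter_iff, Set.mem_diff, Set.mem_univ, true_and]
      tauto
    rw [this]
  refine ⟨?_, key⟩
  ext g
  simp only [YoungStructure.Gset, YoungStructure.Uset, Set.mem_inter_iff, Set.mem_setOf_eq, hfull]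
  rw [← key]
  constructor
  · rintro ⟨⟨_, h1⟩, h2, h3⟩
    exact ⟨h2, h1, h3⟩
  · rintro ⟨h2, h1, h3⟩
    exact ⟨⟨fun i => by rw [h2, one_smul], h1⟩, h2, h3⟩
end

section
/- Let λ and μ be weak partitions of N, let ν denote the one-block weak partition of N, and let G be any one of the three subgroups P_μ^ν, G_μ, U_μ^ν of G_N. Then G is decomposable with respect to (G_λ, U_λ^ν): every element of P_λ^ν ∩ G can be written uniquely as a product g·u with g ∈ G_λ ∩ G and u ∈ U_λ^ν ∩ G, and G_λ ∩ G normalises U_λ^ν ∩ G; thus P_λ^ν ∩ G is the internal semidirect product (G_λ ∩ G) ⋉ (U_λ^ν ∩ G). -/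
open scoped Pointwise

/-- A subset `S` of a group is decomposable with respect to `(Gl, U)` if `Gl ∩ S` normalises
`U ∩ S` and every element of `P ∩ S` factors uniquely as `g * u` with `g ∈ Gl ∩ S`,
`u ∈ U ∩ S` (where `P` is the relevant set `Gl · U`). -/
def DecomposableWrt {G : Type} [Group G] (Gl U P S : Set G) : Prop :=
  (∀ g ∈ Gl ∩ S, ∀ u ∈ U ∩ S, g * u * g⁻¹ ∈ U ∩ S) ∧
  ∀ x ∈ P ∩ S, ∃! p : G × G, p.1 ∈ Gl ∩ S ∧ p.2 ∈ U ∩ S ∧ x = p.1 * p.2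

theorem ypart_stable {N Y I : Type} [Fintype N] [Fintype Y] [MulAction (Equiv.Perm N) Y]
    [Fintype I] (ys : YoungStructure N Y) (lam : WeakPartition N I) (w : Equiv.Perm N)
    (hw : ∀ i, w • lam.blocks i = lam.blocks i) (y : Y) :
    w⁻¹ • y ∈ ys.ypart lam ↔ y ∈ ys.ypart lam := by
  have h : w • ys.ypart lam = ys.ypart lam := by
    unfold YoungStructure.ypart
    rw [Set.smul_set_iUnion]
    exact Set.iUnion_congr fun i => by rw [ys.smul_sub, hw]
  rw [← Set.mem_smul_set_iff_inv_smul_mem, h]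

theorem ypart_full {N Y : Type} [Fintype N] [Fintype Y] [MulAction (Equiv.Perm N) Y]
    (ys : YoungStructure N Y) : ys.ypart (WeakPartition.full N) = Set.univ := by
  apply Set.eq_univ_of_forall
  intro y
  refine Set.mem_iUnion.2 ⟨PUnit.unit, ?_⟩
  change y ∈ ys.sub Set.univ
  rw [ys.sub_univ]
  trivial

theorem wreathAut_apply {N Y H : Type} [Fintype N] [Fintype Y] [MulAction (Equiv.Perm N) Y]
    [Group H] (w : Equiv.Perm N) (f : Y → H) (y : Y) :
    wreathAut N Y H w f y = f (w⁻¹ • y) := rfl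

/-- The common form of all three cases: `S = {(w, f) | w ∈ W, supp f ⊆ A}` with `A` stable
under `W`. -/
theorem decomposable_aux {N Y H I : Type} [Fintype N] [Fintype Y] [MulAction (Equiv.Perm N) Y]
    [Group H] [Fintype I] (ys : YoungStructure N Y) (lam : WeakPartition N I)
    (W : Set (Equiv.Perm N)) (A : Set Y) (h1 : 1 ∈ W)
    (hA : ∀ w ∈ W, ∀ y : Y, w⁻¹ • y ∈ A ↔ y ∈ A) (S : Set (WreathProduct N Y H))
    (hS : ∀ g, g ∈ S ↔ g.right ∈ W ∧ Function.mulSupport g.left ⊆ A) :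
    DecomposableWrt (ys.Gset lam) (ys.Uset lam (WeakPartition.full N))
        (ys.Pset lam (WeakPartition.full N)) S := by
  classical
  have hB := ypart_stable ys lam
  constructor
  · rintro g ⟨⟨hgb, -⟩, hgS⟩ u ⟨⟨hu1, hus⟩, huS⟩
    rw [hS] at hgS huS
    have hr : (g * u * g⁻¹).right = 1 := by simp [hu1]
    have hl : ∀ y, (g * u * g⁻¹).left y = g.left y * u.left (g.right⁻¹ • y) * (g.left y)⁻¹ := by
      intro y
      simp [wreathAut_apply, hu1]
    have hne : ∀ y, (g * u * g⁻¹).left y ≠ 1 → u.left (g.right⁻¹ • y) ≠ 1 := by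
      intro y hy h
      exact hy (by rw [hl, h]; simp)
    refine ⟨⟨hr, fun y hy => ?_⟩, (hS _).2 ⟨hr ▸ h1, fun y hy => ?_⟩⟩
    · have := hus (hne y hy)
      rw [ypart_full] at this ⊢
      exact ⟨trivial, fun h => this.2 ((hB _ hgb y).2 h)⟩
    · exact (hA _ hgS.1 y).1 (huS.2 (hne y hy))
  · rintro x ⟨⟨hxb, -⟩, hxS⟩
    rw [hS] at hxS
    have hB' := hB _ hxb
    let g : WreathProduct N Y H := ⟨fun y => if y ∈ ys.ypart lam then x.left y else 1, x.right⟩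
    let u : WreathProduct N Y H :=
      ⟨fun y => if y ∈ ys.ypart lam then 1 else x.left (x.right • y), 1⟩
    refine ⟨(g, u), ⟨⟨⟨hxb, ?_⟩, (hS _).2 ⟨hxS.1, ?_⟩⟩, ⟨⟨rfl, ?_⟩, (hS _).2 ⟨h1, ?_⟩⟩, ?_⟩, ?_⟩
    · intro y hy
      by_contra h
      exact hy (if_neg h)
    · intro y hy
      apply hxS.2
      intro h
      apply hy
      simp [g, h]
    · intro y hy
      rw [ypart_full]
      exact ⟨trivial, fun h => hy (if_pos h)⟩
    · intro y hy
      have : x.right • y ∈ A := by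
        apply hxS.2
        intro h
        apply hy
        simp [u, h]
      rw [← hA _ hxS.1] at this
      simpa using this
    · apply SemidirectProduct.ext
      · funext y
        by_cases h : y ∈ ys.ypart lam <;> simp [g, u, wreathAut_apply, hB', h]
      · simp [g, u]
    · rintro ⟨a, b⟩ ⟨⟨⟨hab, has⟩, -⟩, ⟨⟨hb1, hbs⟩, -⟩, hx⟩
      dsimp only at hab has hb1 hbs hx
      have har : a.right = x.right := by rw [hx]; simp [hb1]
      have ha : a = g := by
        apply SemidirectProduct.ext
        · funext y
          by_cases h : y ∈ ys.ypart lam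
          · have hb : b.left (a.right⁻¹ • y) = 1 := by
              by_contra hne
              exact (hbs hne).2 ((hB _ hab y).2 h)
            simp only [g, h, if_true]
            rw [hx]
            simp [wreathAut_apply, hb]
          · simp only [g, h, if_false]
            by_contra hne
            exact h (has hne)
        · exact har
      have hgu : x = g * u := by
        apply SemidirectProduct.ext
        · funext y
          by_cases h : y ∈ ys.ypart lam <;> simp [g, u, wreathAut_apply, hB', h]
        · simp [g, u]
      have hb : b = u := by
        rw [ha, hgu] at hx
        exact (mul_left_cancel hx).symm
      rw [ha, hb]

/-- each of `P_μ^ν`, `G_μ`, `U_μ^ν` is decomposable with respect to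
`(G_λ, U_λ^ν)`, where `ν` is the one-block weak partition. -/
theorem statement6 {N Y H I J : Type} [Fintype N] [Fintype Y] [MulAction (Equiv.Perm N) Y]
    [Group H] [Fintype H] [Fintype I] [Fintype J]
    (ys : YoungStructure N Y) (lam : WeakPartition N I) (mu : WeakPartition N J) :
    DecomposableWrt (ys.Gset lam) (ys.Uset lam (WeakPartition.full N))
        (ys.Pset lam (WeakPartition.full N))
        (ys.Pset mu (WeakPartition.full N) : Set (WreathProduct N Y H)) ∧
    DecomposableWrt (ys.Gset lam) (ys.Uset lam (WeakPartition.full N))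
        (ys.Pset lam (WeakPartition.full N))
        (ys.Gset mu : Set (WreathProduct N Y H)) ∧
    DecomposableWrt (ys.Gset lam) (ys.Uset lam (WeakPartition.full N))
        (ys.Pset lam (WeakPartition.full N))
        (ys.Uset mu (WeakPartition.full N) : Set (WreathProduct N Y H)) := by
  refine ⟨?_, ?_, ?_⟩
  · exact decomposable_aux ys lam {w | ∀ i, w • mu.blocks i = mu.blocks i}
      (ys.ypart (WeakPartition.full N)) (by simp) (by simp [ypart_full]) _ fun g => Iff.rfl
  · exact decomposable_aux ys lam {w | ∀ i, w • mu.blocks i = mu.blocks i}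
      (ys.ypart mu) (by simp) (fun w hw => ypart_stable ys mu w hw) _ fun g => Iff.rfl
  · exact decomposable_aux ys lam {1}
      (ys.ypart (WeakPartition.full N) \ ys.ypart mu) (by simp)
      (by rintro w rfl y; simp) _ fun g => Iff.rfl
end

section
/- Let λ ≤ μ ≤ ν be weak partitions of N. Then every element of U_λ^ν can be written uniquely as a product u₁·u₂ with u₁ ∈ U_μ^ν and u₂ ∈ U_λ^μ (indeed U_λ^ν is the internal direct product of the subgroups U_μ^ν and U_λ^μ), and consequently, for every representation ρ of the group G_N on a ℂ-vector space W, the subspace of U_λ^ν-fixed vectors of W equals the intersection of the subspace of U_μ^ν-fixed vectors with the subspace of U_λ^μ-fixed vectors. -/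
open scoped Pointwise

theorem YoungStructure.ypart_mono_aux {N Y I J : Type} [Fintype N] [Fintype Y]
    [MulAction (Equiv.Perm N) Y] [Fintype I] [Fintype J]
    (ys : YoungStructure N Y) (lam : WeakPartition N I) (mu : WeakPartition N J)
    (h : lam.Refines mu) : ys.ypart lam ⊆ ys.ypart mu := by
  intro y hy
  obtain ⟨i, hi⟩ := Set.mem_iUnion.1 hy
  rcases Set.eq_empty_or_nonempty (lam.blocks i) with he | ⟨x, hx⟩
  · rw [he, ys.sub_empty] at hi
    exact hi.elim
  · have hxm : x ∈ ⋃ j, mu.blocks j := mu.iUnion_blocks ▸ Set.mem_univ x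
    obtain ⟨j, hj⟩ := Set.mem_iUnion.1 hxm
    obtain ⟨s, hs⟩ := h j
    rw [hs] at hj
    obtain ⟨i', hi's, hxi'⟩ := Set.mem_iUnion₂.1 hj
    have hii : i = i' := by
      by_contra hne
      exact Set.disjoint_left.1 (lam.disjoint i i' hne) hx hxi'
    subst hii
    have hsub : lam.blocks i ⊆ mu.blocks j := by
      rw [hs]
      exact Set.subset_biUnion_of_mem (u := fun i => lam.blocks i) hi's
    have hint := ys.inter_sub (lam.blocks i) (mu.blocks j)
    rw [Set.inter_eq_left.2 hsub] at hint
    exact Set.mem_iUnion.2 ⟨j, (Set.inter_eq_left.1 hint) hi⟩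

theorem YoungStructure.mem_Uset_aux {N Y H I J : Type} [Fintype N] [Fintype Y]
    [MulAction (Equiv.Perm N) Y] [Group H] [Fintype I] [Fintype J]
    (ys : YoungStructure N Y) (lam : WeakPartition N I) (mu : WeakPartition N J)
    (g : WreathProduct N Y H) :
    g ∈ (ys.Uset lam mu : Set (WreathProduct N Y H)) ↔
      g.right = 1 ∧ ∀ y, g.left y ≠ 1 → y ∈ ys.ypart mu ∧ y ∉ ys.ypart lam :=
  Iff.rfl

theorem wreath_mul_left_aux {N Y H : Type} [Fintype N] [Fintype Y]
    [MulAction (Equiv.Perm N) Y] [Group H] (a b : WreathProduct N Y H) (ha : a.right = 1)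
    (y : Y) : (a * b).left y = a.left y * b.left y := by
  rw [SemidirectProduct.mul_left, ha, map_one]
  rfl

/-- for `λ ≤ μ ≤ ν`, `U_λ^ν` is the internal direct product of `U_μ^ν` and
`U_λ^μ`, and the `U_λ^ν`-fixed vectors of any representation of `G_N` over `ℂ` are the
intersection of the `U_μ^ν`-fixed vectors with the `U_λ^μ`-fixed vectors. -/
theorem statement7 {N Y H I J K : Type} [Fintype N] [Fintype Y] [MulAction (Equiv.Perm N) Y]
    [Group H] [Fintype H] [Fintype I] [Fintype J] [Fintype K]
    (ys : YoungStructure N Y) (lam : WeakPartition N I) (mu : WeakPartition N J)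
    (nu : WeakPartition N K) (hlm : lam.Refines mu) (hmn : mu.Refines nu) :
    ((ys.Uset mu nu : Set (WreathProduct N Y H)) ⊆ ys.Uset lam nu) ∧
    ((ys.Uset lam mu : Set (WreathProduct N Y H)) ⊆ ys.Uset lam nu) ∧
    (∀ x ∈ (ys.Uset lam nu : Set (WreathProduct N Y H)),
      ∃! p : WreathProduct N Y H × WreathProduct N Y H,
        p.1 ∈ ys.Uset mu nu ∧ p.2 ∈ ys.Uset lam mu ∧ x = p.1 * p.2) ∧
    (∀ u₁ ∈ (ys.Uset mu nu : Set (WreathProduct N Y H)), ∀ u₂ ∈ ys.Uset lam mu,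
      u₁ * u₂ = u₂ * u₁) ∧
    ∀ (W : Type) [AddCommGroup W] [Module ℂ W]
      (ρ : Representation ℂ (WreathProduct N Y H) W),
      {x : W | ∀ g ∈ (ys.Uset lam nu : Set (WreathProduct N Y H)), ρ g x = x} =
        {x : W | ∀ g ∈ (ys.Uset mu nu : Set (WreathProduct N Y H)), ρ g x = x} ∩
        {x : W | ∀ g ∈ (ys.Uset lam mu : Set (WreathProduct N Y H)), ρ g x = x} := by
  have h1 := ys.ypart_mono_aux lam mu hlm
  have h2 := ys.ypart_mono_aux mu nu hmn
  have hA : (ys.Uset mu nu : Set (WreathProduct N Y H)) ⊆ ys.Uset lam nu :=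
    fun g hg => ⟨hg.1, fun y hy => ⟨(hg.2 hy).1, fun h => (hg.2 hy).2 (h1 h)⟩⟩
  have hB : (ys.Uset lam mu : Set (WreathProduct N Y H)) ⊆ ys.Uset lam nu :=
    fun g hg => ⟨hg.1, fun y hy => ⟨h2 (hg.2 hy).1, (hg.2 hy).2⟩⟩
  have hC : ∀ x ∈ (ys.Uset lam nu : Set (WreathProduct N Y H)),
      ∃! p : WreathProduct N Y H × WreathProduct N Y H,
        p.1 ∈ ys.Uset mu nu ∧ p.2 ∈ ys.Uset lam mu ∧ x = p.1 * p.2 := by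
    classical
    intro x hx
    rw [ys.mem_Uset_aux] at hx
    obtain ⟨hx1, hx2⟩ := hx
    refine ⟨(⟨fun y => if y ∈ ys.ypart mu then 1 else x.left y, 1⟩,
      ⟨fun y => if y ∈ ys.ypart mu then x.left y else 1, 1⟩), ⟨?_, ?_, ?_⟩, ?_⟩
    · rw [ys.mem_Uset_aux]
      refine ⟨rfl, fun y hy => ?_⟩
      by_cases hm : y ∈ ys.ypart mu
      · simp [hm] at hy
      · simp only [hm, if_false] at hy
        exact ⟨(hx2 y hy).1, hm⟩
    · rw [ys.mem_Uset_aux]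
      refine ⟨rfl, fun y hy => ?_⟩
      by_cases hm : y ∈ ys.ypart mu
      · simp only [hm, if_true] at hy
        exact ⟨hm, (hx2 y hy).2⟩
      · simp [hm] at hy
    · refine SemidirectProduct.ext (funext fun y => ?_) ?_
      · rw [wreath_mul_left_aux _ _ rfl]
        by_cases hm : y ∈ ys.ypart mu <;> simp [hm]
      · simp [hx1]
    · rintro ⟨a, b⟩ ⟨ha, hb, hab⟩
      simp only [ys.mem_Uset_aux] at ha hb
      have key : ∀ y, x.left y = a.left y * b.left y := fun y => by
        rw [hab]
        exact wreath_mul_left_aux a b ha.1 y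
      have hay : ∀ y, y ∈ ys.ypart mu → a.left y = 1 := fun y hm => by
        by_contra hne
        exact (ha.2 y hne).2 hm
      have hby : ∀ y, y ∉ ys.ypart mu → b.left y = 1 := fun y hm => by
        by_contra hne
        exact hm (hb.2 y hne).1
      refine Prod.ext (SemidirectProduct.ext (funext fun y => ?_) ha.1)
        (SemidirectProduct.ext (funext fun y => ?_) hb.1)
      · by_cases hm : y ∈ ys.ypart mu
        · simp [hm, hay y hm]
        · simp [hm, key, hby y hm]
      · by_cases hm : y ∈ ys.ypart mu
        · simp [hm, key, hay y hm]
        · simp [hm, hby y hm]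
  refine ⟨hA, hB, hC, ?_, ?_⟩
  · intro a ha b hb
    rw [ys.mem_Uset_aux] at ha hb
    refine SemidirectProduct.ext (funext fun y => ?_) ?_
    · rw [wreath_mul_left_aux _ _ ha.1, wreath_mul_left_aux _ _ hb.1]
      by_cases hm : y ∈ ys.ypart mu
      · have : a.left y = 1 := by
          by_contra hne
          exact (ha.2 y hne).2 hm
        simp [this]
      · have : b.left y = 1 := by
          by_contra hne
          exact hm (hb.2 y hne).1
        simp [this]
    · simp [ha.1, hb.1]
  · intro W _ _ ρ
    ext v
    constructor
    · intro hv
      exact ⟨fun g hg => hv g (hA hg), fun g hg => hv g (hB hg)⟩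
    · rintro ⟨hv1, hv2⟩ g hg
      obtain ⟨⟨a, b⟩, ⟨ha, hb, hab⟩, -⟩ := hC g hg
      rw [hab, map_mul, Module.End.mul_apply, hv2 b hb, hv1 a ha]
end

section
/- The functor 'inflate from L to P and then induce from P to G' is a two-sided adjoint to the functor 'restrict from G to P and then take U-fixed vectors', in the following Hom-space form: for every finite-dimensional ℂ-linear representation V of L and every finite-dimensional ℂ-linear representation W of G, dim Hom_G(Ind_P^G(infl V), W) = dim Hom_L(V, W^U) and dim Hom_G(W, Ind_P^G(infl V)) = dim Hom_L(W^U, V). -/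
/-- The space of equivariant linear maps between two representations. -/
def repHom {k G A B : Type} [CommRing k] [Monoid G]
    [AddCommGroup A] [Module k A] [AddCommGroup B] [Module k B]
    (rhoA : Representation k G A) (rhoB : Representation k G B) :
    Submodule k (A →ₗ[k] B) where
  carrier := {T | ∀ (g : G) (a : A), T (rhoA g a) = rhoB g (T a)}
  add_mem' := by intro T S hT hS g a; simp [hT g a, hS g a]
  zero_mem' := by intro g a; simp
  smul_mem' := by intro c T hT g a; simp [hT g a]

/-- The dimension of the space of equivariant linear maps between two representations. -/
noncomputable def homDim {k G A B : Type} [CommRing k] [Monoid G]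
    [AddCommGroup A] [Module k A] [AddCommGroup B] [Module k B]
    (rhoA : Representation k G A) (rhoB : Representation k G B) : ℕ :=
  Module.finrank k ↥(repHom rhoA rhoB)

/-- The underlying space of the induced representation `Ind_P^G`: functions `f : G → V`
with `f (p * g) = ρ p (f g)`. -/
def indSpace {k G V : Type} [CommRing k] [Group G] [AddCommGroup V] [Module k V]
    (P : Subgroup G) (rho : Representation k ↥P V) : Submodule k (G → V) where
  carrier := {f | ∀ (p : ↥P) (g : G), f (↑p * g) = rho p (f g)}
  add_mem' := by intro a b ha hb p g; simp [ha p g, hb p g]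
  zero_mem' := by intro p g; simp
  smul_mem' := by intro c a ha p g; simp [ha p g]

/-- The induced representation `Ind_P^G`, with `G` acting by right translation. -/
def indRep {k G V : Type} [CommRing k] [Group G] [AddCommGroup V] [Module k V]
    (P : Subgroup G) (rho : Representation k ↥P V) :
    Representation k G ↥(indSpace P rho) where
  toFun g :=
    { toFun := fun f => ⟨fun x => f.1 (x * g), fun p x => by
        show f.1 ((↑p * x) * g) = rho p (f.1 (x * g))
        rw [mul_assoc]; exact f.2 p (x * g)⟩
      map_add' := fun f f' => Subtype.ext (funext fun x => rfl)
      map_smul' := fun c f => Subtype.ext (funext fun x => rfl) }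
  map_one' := LinearMap.ext fun f => Subtype.ext (funext fun x => by
    show f.1 (x * 1) = f.1 x
    rw [mul_one])
  map_mul' := fun g h => LinearMap.ext fun f => Subtype.ext (funext fun x => by
    show f.1 (x * (g * h)) = f.1 (x * g * h)
    rw [mul_assoc])

/-- The submodule of `U`-fixed vectors of a representation. -/
def fixedU {k G W : Type} [CommRing k] [Group G] [AddCommGroup W] [Module k W]
    (rho : Representation k G W) (U : Subgroup G) : Submodule k W where
  carrier := {w | ∀ u ∈ U, rho u w = w}
  add_mem' := by intro a b ha hb u hu; simp [ha u hu, hb u hu]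
  zero_mem' := by intro u hu; simp
  smul_mem' := by intro c a ha u hu; simp [ha u hu]

/-- The representation of `L` on the `U`-fixed vectors `W^U` (for `L ≤ P` and `U`
normalised by `P`). -/
def fixedRep {k G W : Type} [CommRing k] [Group G] [AddCommGroup W] [Module k W]
    (rho : Representation k G W) (P U L : Subgroup G) (hLP : L ≤ P)
    (hUnorm : ∀ p ∈ P, ∀ u ∈ U, p * u * p⁻¹ ∈ U) :
    Representation k ↥L ↥(fixedU rho U) where
  toFun l :=
    { toFun := fun w => ⟨rho (l : G) w.1, by
        intro u hu
        have hmem : (l : G)⁻¹ * u * (l : G) ∈ U := by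
          have h := hUnorm ((l : G)⁻¹) (P.inv_mem (hLP l.2)) u hu
          simpa using h
        have key : u * (l : G) = (l : G) * ((l : G)⁻¹ * u * (l : G)) := by group
        calc rho u (rho (l : G) w.1) = rho (u * (l : G)) w.1 := by
              rw [map_mul]; rfl
          _ = rho ((l : G) * ((l : G)⁻¹ * u * (l : G))) w.1 := by rw [← key]
          _ = rho (l : G) (rho ((l : G)⁻¹ * u * (l : G)) w.1) := by rw [map_mul]; rfl
          _ = rho (l : G) w.1 := by rw [w.2 _ hmem]⟩
      map_add' := fun w w' => Subtype.ext (by simp)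
      map_smul' := fun c w => Subtype.ext (by simp) }
  map_one' := LinearMap.ext fun w => Subtype.ext (by simp)
  map_mul' := fun l l' => LinearMap.ext fun w => Subtype.ext (by
    show rho ((l * l' : ↥L) : G) w.1 = rho (l : G) (rho (l' : G) w.1)
    rw [Subgroup.coe_mul, map_mul]; rfl)

open Classical in
/-- The function supported on `P` with value `v` at `1`. -/
noncomputable def deltaFun {G V : Type} [Group G] [AddCommGroup V] [Module ℂ V]
    (P : Subgroup G) (rho : Representation ℂ ↥P V) : V →ₗ[ℂ] ↥(indSpace P rho) where
  toFun v := ⟨fun g => if h : g ∈ P then rho ⟨g, h⟩ v else 0, by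
    intro p g
    by_cases h : g ∈ P
    · have h' : (p : G) * g ∈ P := P.mul_mem p.2 h
      have e : (⟨(p : G) * g, h'⟩ : ↥P) = p * ⟨g, h⟩ := rfl
      simp only [h, h', dite_true]
      rw [e, map_mul]; rfl
    · have h' : (p : G) * g ∉ P := fun h' => h ((P.mul_mem_cancel_left p.2).1 h')
      simp [h, h']⟩
  map_add' v w := by
    apply Subtype.ext; funext g
    by_cases h : g ∈ P <;> simp [h]
  map_smul' c w := by
    apply Subtype.ext; funext g
    by_cases h : g ∈ P <;> simp [h]

lemma deltaFun_mem {G V : Type} [Group G] [AddCommGroup V] [Module ℂ V]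
    (P : Subgroup G) (rho : Representation ℂ ↥P V) (v : V) (g : G) (h : g ∈ P) :
    (deltaFun P rho v).1 g = rho ⟨g, h⟩ v := by
  simp [deltaFun, h]

lemma deltaFun_not_mem {G V : Type} [Group G] [AddCommGroup V] [Module ℂ V]
    (P : Subgroup G) (rho : Representation ℂ ↥P V) (v : V) (g : G) (h : g ∉ P) :
    (deltaFun P rho v).1 g = 0 := by
  simp [deltaFun, h]

lemma indRep_deltaFun {G V : Type} [Group G] [AddCommGroup V] [Module ℂ V]
    (P : Subgroup G) (rho : Representation ℂ ↥P V) (p : ↥P) (v : V) :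
    indRep P rho p (deltaFun P rho v) = deltaFun P rho (rho p v) := by
  apply Subtype.ext; funext g
  change (deltaFun P rho v).1 (g * p) = (deltaFun P rho (rho p v)).1 g
  by_cases h : g ∈ P
  · have h' : g * (p : G) ∈ P := P.mul_mem h p.2
    have e : (⟨g * (p : G), h'⟩ : ↥P) = ⟨g, h⟩ * p := rfl
    rw [deltaFun_mem _ _ _ _ h, deltaFun_mem _ _ _ _ h', e, map_mul]; rfl
  · have h' : g * (p : G) ∉ P := fun h' => h ((P.mul_mem_cancel_right p.2).1 h')
    rw [deltaFun_not_mem _ _ _ _ h, deltaFun_not_mem _ _ _ _ h']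

/-- A sum over `G` of a function vanishing off `P`. -/
lemma sum_subgroup_const {G M : Type} [Group G] [Fintype G] [AddCommGroup M] [Module ℂ M]
    (P : Subgroup G) (F : G → M) (m : M) (h1 : ∀ g ∈ P, F g = m) (h2 : ∀ g ∉ P, F g = 0) :
    ∑ g, F g = (Nat.card ↥P : ℂ) • m := by
  classical
  have : ∀ g, F g = if g ∈ P then m else 0 := by
    intro g
    by_cases h : g ∈ P
    · simp [h, h1]
    · simp [h, h2]
  simp_rw [this]
  rw [← Finset.sum_filter, Finset.sum_const, Nat.card_eq_fintype_card, Fintype.card_subtype,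
    Nat.cast_smul_eq_nsmul]

lemma card_smul_eq_sum {G V : Type} [Group G] [Fintype G] [AddCommGroup V] [Module ℂ V]
    (P : Subgroup G) (rho : Representation ℂ ↥P V) (f : ↥(indSpace P rho)) :
    ∑ g : G, indRep P rho g⁻¹ (deltaFun P rho (f.1 g)) = (Nat.card ↥P : ℂ) • f := by
  apply Subtype.ext; funext x
  have e : (∑ g : G, indRep P rho g⁻¹ (deltaFun P rho (f.1 g))).1 x =
      ∑ g : G, (deltaFun P rho (f.1 g)).1 (x * g⁻¹) := by
    rw [AddSubmonoidClass.coe_finsetSum, Finset.sum_apply]; rfl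
  rw [e, ← Equiv.sum_comp ((Equiv.inv G).trans (Equiv.mulRight x))]
  refine sum_subgroup_const P _ (f.1 x) ?_ ?_
  · intro g hg
    have h' : x * (g⁻¹ * x)⁻¹ = g := by group
    change (deltaFun P rho (f.1 (g⁻¹ * x))).1 (x * (g⁻¹ * x)⁻¹) = _
    rw [h', deltaFun_mem _ _ _ _ hg, ← f.2 ⟨g, hg⟩]
    simp
  · intro g hg
    have h' : x * (g⁻¹ * x)⁻¹ = g := by group
    change (deltaFun P rho (f.1 (g⁻¹ * x))).1 (x * (g⁻¹ * x)⁻¹) = _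
    rw [h', deltaFun_not_mem _ _ _ _ hg]

open Classical in
/-- Averaging over `U`. -/
noncomputable def avgU {G W : Type} [Group G] [Fintype G] [AddCommGroup W] [Module ℂ W]
    (rho : Representation ℂ G W) (U : Subgroup G) : W →ₗ[ℂ] W :=
  (Nat.card ↥U : ℂ)⁻¹ • ∑ u : ↥U, rho (u : G)

lemma avgU_apply {G W : Type} [Group G] [Fintype G] [AddCommGroup W] [Module ℂ W]
    (rho : Representation ℂ G W) (U : Subgroup G) [Fintype ↥U] (w : W) :
    avgU rho U w = (Nat.card ↥U : ℂ)⁻¹ • ∑ u : ↥U, rho (u : G) w := by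
  rw [avgU, LinearMap.smul_apply, LinearMap.sum_apply]
  congr!

lemma avgU_mem {G W : Type} [Group G] [Fintype G] [AddCommGroup W] [Module ℂ W]
    (rho : Representation ℂ G W) (U : Subgroup G) (w : W) : avgU rho U w ∈ fixedU rho U := by
  classical
  intro u hu
  rw [avgU_apply, map_smul, map_sum]
  congr 1
  rw [← Equiv.sum_comp (Equiv.mulLeft (⟨u, hu⟩ : ↥U)) (fun x : ↥U => rho (x : G) w)]
  refine Finset.sum_congr rfl fun x _ => ?_
  simp

lemma avgU_fixed {G W : Type} [Group G] [Fintype G] [AddCommGroup W] [Module ℂ W]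
    (rho : Representation ℂ G W) (U : Subgroup G) (w : W) (hw : w ∈ fixedU rho U) :
    avgU rho U w = w := by
  classical
  rw [avgU_apply, Finset.sum_congr rfl (fun (x : ↥U) _ => hw x.1 x.2), Finset.sum_const,
    Finset.card_univ, ← Nat.card_eq_fintype_card, ← Nat.cast_smul_eq_nsmul ℂ, smul_smul,
    inv_mul_cancel₀ (by exact_mod_cast Nat.card_pos.ne'), one_smul]

lemma avgU_comm {G W : Type} [Group G] [Fintype G] [AddCommGroup W] [Module ℂ W]
    (rho : Representation ℂ G W) (U : Subgroup G) (p : G)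
    (hp : ∀ u ∈ U, p * u * p⁻¹ ∈ U) (hp' : ∀ u ∈ U, p⁻¹ * u * p ∈ U) (w : W) :
    avgU rho U (rho p w) = rho p (avgU rho U w) := by
  classical
  rw [avgU_apply, avgU_apply, map_smul, map_sum]
  congr 1
  let e : ↥U ≃ ↥U :=
    { toFun := fun u => ⟨p * u * p⁻¹, hp u u.2⟩
      invFun := fun u => ⟨p⁻¹ * u * p, hp' u u.2⟩
      left_inv := fun u => Subtype.ext (by simp [mul_assoc])
      right_inv := fun u => Subtype.ext (by simp [mul_assoc]) }
  rw [← Equiv.sum_comp e]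
  refine Finset.sum_congr rfl fun x _ => ?_
  change rho (p * x * p⁻¹) (rho p w) = rho p (rho x w)
  rw [← Module.End.mul_apply, ← Module.End.mul_apply, ← map_mul, ← map_mul]
  simp

lemma q_U {G : Type} [Group G] (P U L : Subgroup G)
    (hLU : L ⊓ U = ⊥)
    (q : ↥P →* ↥L) (hq : ∀ p : ↥P, ∃ u ∈ U, (p : G) = ((q p : ↥L) : G) * u)
    (u : ↥P) (hu : (u : G) ∈ U) : q u = 1 := by
  obtain ⟨u', hu', h⟩ := hq u
  have h1 : ((q u : ↥L) : G) = u * u'⁻¹ := by rw [h]; group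
  have h2 : ((q u : ↥L) : G) ∈ L ⊓ U :=
    ⟨(q u).2, by rw [h1]; exact U.mul_mem hu (U.inv_mem hu')⟩
  rw [hLU, Subgroup.mem_bot] at h2
  exact Subtype.ext h2

lemma q_L {G : Type} [Group G] (P U L : Subgroup G) (hLP : L ≤ P)
    (hLU : L ⊓ U = ⊥)
    (q : ↥P →* ↥L) (hq : ∀ p : ↥P, ∃ u ∈ U, (p : G) = ((q p : ↥L) : G) * u)
    (l : ↥L) : q ⟨l, hLP l.2⟩ = l := by
  obtain ⟨u', hu', h⟩ := hq ⟨l, hLP l.2⟩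
  have h1 : u' = ((q ⟨l, hLP l.2⟩ : ↥L) : G)⁻¹ * l := by
    rw [eq_inv_mul_iff_mul_eq]; exact h.symm
  have h2 : u' ∈ L ⊓ U :=
    ⟨by rw [h1]; exact L.mul_mem (L.inv_mem (q _).2) l.2, hu'⟩
  rw [hLU, Subgroup.mem_bot] at h2
  apply Subtype.ext
  rw [h2, mul_one] at h
  exact h.symm

lemma rho_q {G : Type} [Group G] (P U L : Subgroup G)
    (q : ↥P →* ↥L) (hq : ∀ p : ↥P, ∃ u ∈ U, (p : G) = ((q p : ↥L) : G) * u)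
    {W : Type} [AddCommGroup W] [Module ℂ W] (rhoW : Representation ℂ G W)
    (p : ↥P) (w : W) (hw : w ∈ fixedU rhoW U) : rhoW p w = rhoW (q p) w := by
  obtain ⟨u, hu, h⟩ := hq p
  rw [h, map_mul, Module.End.mul_apply, hw u hu]

set_option maxHeartbeats 1000000 in
set_option synthInstance.maxHeartbeats 1000000 in
lemma part1 {G : Type} [Group G] [Fintype G] (P U L : Subgroup G) (hUP : U ≤ P) (hLP : L ≤ P)
    (hUnorm : ∀ p ∈ P, ∀ u ∈ U, p * u * p⁻¹ ∈ U)
    (hLU : L ⊓ U = ⊥)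
    (q : ↥P →* ↥L) (hq : ∀ p : ↥P, ∃ u ∈ U, (p : G) = ((q p : ↥L) : G) * u)
    {V : Type} [AddCommGroup V] [Module ℂ V] (rhoV : Representation ℂ ↥L V)
    {W : Type} [AddCommGroup W] [Module ℂ W] (rhoW : Representation ℂ G W) :
    homDim (indRep P ((rhoV.comp q : ↥P →* _) : Representation ℂ ↥P V)) rhoW =
      homDim rhoV (fixedRep rhoW P U L hLP hUnorm) := by
  set rho : Representation ℂ ↥P V := rhoV.comp q with hrho
  have hr : ∀ p v, rho p v = rhoV (q p) v := fun _ _ => rfl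
  let Φ : ↥(repHom (indRep P rho) rhoW) →ₗ[ℂ]
      ↥(repHom rhoV (fixedRep rhoW P U L hLP hUnorm)) :=
    { toFun := fun T => ⟨(T.1 ∘ₗ deltaFun P rho).codRestrict (fixedU rhoW U) (by
          intro v u hu
          change rhoW u (T.1 (deltaFun P rho v)) = T.1 (deltaFun P rho v)
          rw [← T.2 u, indRep_deltaFun P rho ⟨u, hUP hu⟩, hr,
            q_U P U L hLU q hq ⟨u, hUP hu⟩ hu, map_one]; rfl), by
          intro l v
          apply Subtype.ext
          change T.1 (deltaFun P rho (rhoV l v)) = rhoW l (T.1 (deltaFun P rho v))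
          rw [← T.2 l, indRep_deltaFun P rho ⟨l, hLP l.2⟩, hr, q_L P U L hLP hLU q hq l]⟩
      map_add' := fun T S => rfl
      map_smul' := fun c T => rfl }
  have hΦ : ∀ T v, ((Φ T).1 v).1 = T.1 (deltaFun P rho v) := fun _ _ => rfl
  have hc : (Nat.card ↥P : ℂ) ≠ 0 := by exact_mod_cast Nat.card_pos.ne'
  refine (LinearEquiv.ofBijective Φ ⟨?_, ?_⟩).finrank_eq
  · rw [injective_iff_map_eq_zero]
    intro T hT
    have h0 : ∀ v, T.1 (deltaFun P rho v) = 0 := by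
      intro v; rw [← hΦ, hT]; rfl
    apply Subtype.ext; apply LinearMap.ext; intro f
    have h := congrArg T.1 (card_smul_eq_sum P rho f)
    rw [map_sum, Finset.sum_eq_zero, map_smul] at h
    · exact (smul_eq_zero.1 h.symm).resolve_left hc
    · intro g _
      rw [T.2, h0, map_zero]
  · intro S
    have hS : ∀ (l : ↥L) v, (S.1 (rhoV l v)).1 = rhoW l (S.1 v).1 := fun l v =>
      congrArg Subtype.val (S.2 l v)
    let T : ↥(indSpace P rho) →ₗ[ℂ] W :=
      { toFun := fun f => (Nat.card ↥P : ℂ)⁻¹ • ∑ g : G, rhoW g⁻¹ (S.1 (f.1 g)).1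
        map_add' := by
          intro f f'
          simp [Finset.sum_add_distrib]
        map_smul' := by
          intro c f
          simp only [SetLike.val_smul, Pi.smul_apply, map_smul, RingHom.id_apply]
          rw [← Finset.smul_sum, smul_comm] }
    refine ⟨⟨T, ?_⟩, ?_⟩
    · intro x f
      change (Nat.card ↥P : ℂ)⁻¹ • ∑ g : G, rhoW g⁻¹ (S.1 (f.1 (g * x))).1 =
        rhoW x ((Nat.card ↥P : ℂ)⁻¹ • ∑ g : G, rhoW g⁻¹ (S.1 (f.1 g)).1)
      rw [map_smul, map_sum]
      congr 1
      rw [← Equiv.sum_comp (Equiv.mulRight x) (fun g => rhoW x (rhoW g⁻¹ (S.1 (f.1 g)).1))]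
      refine Finset.sum_congr rfl fun g _ => ?_
      rw [← Module.End.mul_apply, ← map_mul]
      simp
    · apply Subtype.ext; apply LinearMap.ext; intro v; apply Subtype.ext
      rw [hΦ]
      change (Nat.card ↥P : ℂ)⁻¹ • ∑ g : G, rhoW g⁻¹ (S.1 ((deltaFun P rho v).1 g)).1 = _
      rw [sum_subgroup_const P _ (S.1 v).1, smul_smul, inv_mul_cancel₀ hc, one_smul]
      · intro g hg
        rw [deltaFun_mem _ _ _ _ hg, hr, hS, ← rho_q P U L q hq rhoW ⟨g, hg⟩ _ (S.1 v).2,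
          ← Module.End.mul_apply, ← map_mul]
        simp
      · intro g hg
        rw [deltaFun_not_mem _ _ _ _ hg]
        simp

lemma part2 {G : Type} [Group G] [Fintype G] (P U L : Subgroup G) (hUP : U ≤ P) (hLP : L ≤ P)
    (hUnorm : ∀ p ∈ P, ∀ u ∈ U, p * u * p⁻¹ ∈ U)
    (hLU : L ⊓ U = ⊥)
    (q : ↥P →* ↥L) (hq : ∀ p : ↥P, ∃ u ∈ U, (p : G) = ((q p : ↥L) : G) * u)
    {V : Type} [AddCommGroup V] [Module ℂ V] (rhoV : Representation ℂ ↥L V)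
    {W : Type} [AddCommGroup W] [Module ℂ W] (rhoW : Representation ℂ G W) :
    homDim rhoW (indRep P ((rhoV.comp q : ↥P →* _) : Representation ℂ ↥P V)) =
      homDim (fixedRep rhoW P U L hLP hUnorm) rhoV := by
  set rho : Representation ℂ ↥P V := rhoV.comp q with hrho
  have hr : ∀ p v, rho p v = rhoV (q p) v := fun _ _ => rfl
  have hT1 : ∀ (T : ↥(repHom rhoW (indRep P rho))) (g : G) (w : W),
      (T.1 (rhoW g w)).1 1 = (T.1 w).1 g := by
    intro T g w
    rw [T.2]
    change (T.1 w).1 (1 * g) = _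
    rw [one_mul]
  have hTp : ∀ (T : ↥(repHom rhoW (indRep P rho))) (p : ↥P) (w : W),
      (T.1 w).1 p = rhoV (q p) ((T.1 w).1 1) := by
    intro T p w
    have h := (T.1 w).2 p 1
    rwa [mul_one, hr] at h
  let Φ : ↥(repHom rhoW (indRep P rho)) →ₗ[ℂ]
      ↥(repHom (fixedRep rhoW P U L hLP hUnorm) rhoV) :=
    { toFun := fun T => ⟨(LinearMap.proj 1 ∘ₗ (indSpace P rho).subtype ∘ₗ T.1) ∘ₗ
          (fixedU rhoW U).subtype, by
          intro l w
          change (T.1 (rhoW l w.1)).1 1 = rhoV l ((T.1 w.1).1 1)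
          rw [hT1, hTp T ⟨l, hLP l.2⟩, q_L P U L hLP hLU q hq l]⟩
      map_add' := fun T S => rfl
      map_smul' := fun c T => rfl }
  have hΦ : ∀ T w, (Φ T).1 w = (T.1 w.1).1 1 := fun _ _ => rfl
  have hc : (Nat.card ↥U : ℂ) ≠ 0 := by exact_mod_cast Nat.card_pos.ne'
  refine (LinearEquiv.ofBijective Φ ⟨?_, ?_⟩).finrank_eq
  · intro T T₂ hT
    have h2 : ∀ (T : ↥(repHom rhoW (indRep P rho))) (w : W),
        (T.1 (avgU rhoW U w)).1 1 = (T.1 w).1 1 := by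
      classical
      intro T w
      let ev : W →ₗ[ℂ] V := LinearMap.proj 1 ∘ₗ (indSpace P rho).subtype ∘ₗ T.1
      change ev (avgU rhoW U w) = ev w
      have h3 : ∀ u : ↥U, ev (rhoW u w) = ev w := by
        intro u
        change (T.1 (rhoW u w)).1 1 = (T.1 w).1 1
        rw [hT1, hTp T ⟨u, hUP u.2⟩, q_U P U L hLU q hq ⟨u, hUP u.2⟩ u.2, map_one]; rfl
      rw [avgU_apply, map_smul, map_sum, Finset.sum_congr rfl (fun u _ => h3 u),
        Finset.sum_const, Finset.card_univ, ← Nat.card_eq_fintype_card,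
        ← Nat.cast_smul_eq_nsmul ℂ, smul_smul, inv_mul_cancel₀ hc, one_smul]
    have h0 : ∀ w, (T.1 w).1 1 = (T₂.1 w).1 1 := by
      intro w
      rw [← h2 T, ← h2 T₂, ← hΦ T ⟨_, avgU_mem rhoW U w⟩, hT, hΦ]
    apply Subtype.ext; apply LinearMap.ext; intro w; apply Subtype.ext; funext g
    rw [← hT1, h0, hT1]
  · intro S
    have hS : ∀ (l : ↥L) w, S.1 (fixedRep rhoW P U L hLP hUnorm l w) = rhoV l (S.1 w) := S.2
    let A : W →ₗ[ℂ] ↥(fixedU rhoW U) := (avgU rhoW U).codRestrict _ (avgU_mem rhoW U)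
    have hA : ∀ (p : ↥P) w, A (rhoW p w) = fixedRep rhoW P U L hLP hUnorm (q p) (A w) := by
      intro p w
      apply Subtype.ext
      change avgU rhoW U (rhoW p w) = rhoW (q p) (avgU rhoW U w)
      rw [← rho_q P U L q hq rhoW p _ (avgU_mem rhoW U w)]
      refine avgU_comm rhoW U p (hUnorm p p.2) ?_ w
      intro u hu
      simpa using hUnorm (p : G)⁻¹ (P.inv_mem p.2) u hu
    let T : W →ₗ[ℂ] ↥(indSpace P rho) :=
      { toFun := fun w => ⟨fun g => S.1 (A (rhoW g w)), by
          intro p g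
          change S.1 (A (rhoW (p * g) w)) = rho p (S.1 (A (rhoW g w)))
          rw [map_mul, Module.End.mul_apply, hA, hS, hr]⟩
        map_add' := fun w w' => Subtype.ext (funext fun g => by simp)
        map_smul' := fun c w => Subtype.ext (funext fun g => by simp) }
    refine ⟨⟨T, ?_⟩, ?_⟩
    · intro x w
      apply Subtype.ext; funext g
      change S.1 (A (rhoW g (rhoW x w))) = S.1 (A (rhoW (g * x) w))
      rw [map_mul, Module.End.mul_apply]
    · apply Subtype.ext; apply LinearMap.ext; intro w
      rw [hΦ]
      change S.1 (A (rhoW 1 w.1)) = S.1 w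
      congr 1
      apply Subtype.ext
      change avgU rhoW U (rhoW 1 w.1) = w.1
      rw [map_one]
      exact avgU_fixed rhoW U w.1 w.2

set_option maxHeartbeats 1000000 in
set_option synthInstance.maxHeartbeats 1000000 in
/-- `Ind_P^G ∘ infl` is a two-sided adjoint of `(restriction to P) ∘ (U-fixed
vectors)`, at the level of dimensions of Hom-spaces of equivariant maps. -/
theorem statement8 {G : Type} [Group G] [Fintype G]
    (P U L : Subgroup G) (hUP : U ≤ P) (hLP : L ≤ P)
    (hUnorm : ∀ p ∈ P, ∀ u ∈ U, p * u * p⁻¹ ∈ U)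
    (hLU : L ⊓ U = ⊥)
    (q : ↥P →* ↥L)
    (hq : ∀ p : ↥P, ∃ u ∈ U, (p : G) = ((q p : ↥L) : G) * u)
    (V : Type) [AddCommGroup V] [Module ℂ V] [FiniteDimensional ℂ V]
    (rhoV : Representation ℂ ↥L V)
    (W : Type) [AddCommGroup W] [Module ℂ W] [FiniteDimensional ℂ W]
    (rhoW : Representation ℂ G W) :
    homDim (indRep P ((rhoV.comp q : ↥P →* _) : Representation ℂ ↥P V)) rhoW =
      homDim rhoV (fixedRep rhoW P U L hLP hUnorm) ∧
    homDim rhoW (indRep P ((rhoV.comp q : ↥P →* _) : Representation ℂ ↥P V)) =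
      homDim (fixedRep rhoW P U L hLP hUnorm) rhoV := by
  exact ⟨part1 P U L hUP hLP hUnorm hLU q hq rhoV rhoW,
    part2 P U L hUP hLP hUnorm hLU q hq rhoV rhoW⟩
end

section
/- The action of Aut Γ on the proper colourings of Γ is free if and only if for every integer composition α of card V and every irreducible finite-dimensional ℂ-linear representation γ of Aut Γ, the dimension of Hom_{Aut Γ}(ℂ[Col_{Γ,α}], γ) equals the dimension of γ multiplied by the number of orbits of Aut Γ on Col_{Γ,α}. -/
/-- A representation is irreducible if it is nonzero and has no nonzero proper
invariant subspace. -/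
def IsIrreducibleRep {k G A : Type} [CommRing k] [Monoid G] [AddCommGroup A] [Module k A]
    (rho : Representation k G A) : Prop :=
  (∃ a : A, a ≠ 0) ∧
    ∀ p : Submodule k A, (∀ (g : G), ∀ x ∈ p, rho g x ∈ p) → p = ⊥ ∨ p = ⊤

/-- The automorphism group of a simple graph `Γ`, as a subgroup of `Equiv.Perm V`. -/
def graphAut {V : Type} (G : SimpleGraph V) : Subgroup (Equiv.Perm V) where
  carrier := {w | ∀ u v : V, G.Adj (w u) (w v) ↔ G.Adj u v}
  one_mem' := by intro u v; simp
  mul_mem' := by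
    intro a b ha hb u v
    rw [Equiv.Perm.mul_apply, Equiv.Perm.mul_apply]
    exact (ha _ _).trans (hb _ _)
  inv_mem' := by
    intro a ha u v
    simpa using (ha (a⁻¹ u) (a⁻¹ v)).symm

lemma graphAut.adj_iff {V : Type} {G : SimpleGraph V} (g : ↥(graphAut G)) (u v : V) :
    G.Adj ((g : Equiv.Perm V) u) ((g : Equiv.Perm V) v) ↔ G.Adj u v :=
  g.2 u v

/-- The set of proper `m`-colourings of the graph `G`. -/
def Col {V : Type} (G : SimpleGraph V) (m : ℕ) : Type :=
  {κ : V → Fin m // ∀ u v : V, G.Adj u v → κ u ≠ κ v}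

/-- The action of `graphAut G` on proper `m`-colourings: `(g • κ) v = κ (g⁻¹ v)`. -/
instance {V : Type} (G : SimpleGraph V) (m : ℕ) : MulAction ↥(graphAut G) (Col G m) where
  smul g κ := ⟨fun v => κ.1 (((g⁻¹ : ↥(graphAut G)) : Equiv.Perm V) v), fun u v huv =>
    κ.2 _ _ ((graphAut.adj_iff g⁻¹ u v).mpr huv)⟩
  one_smul κ := Subtype.ext (funext fun v => by
    show κ.1 (((1 : ↥(graphAut G))⁻¹ : Equiv.Perm V) v) = κ.1 v
    simp)
  mul_smul g h κ := Subtype.ext (funext fun v => by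
    show κ.1 ((((g * h)⁻¹ : ↥(graphAut G)) : Equiv.Perm V) v) =
      κ.1 ((h⁻¹ : ↥(graphAut G)).1 ((g⁻¹ : ↥(graphAut G)).1 v))
    simp [mul_inv_rev])

/-- The action of `graphAut G` on the proper colourings of `G` is free. -/
def FreeColAction {V : Type} (G : SimpleGraph V) : Prop :=
  ∀ (m : ℕ) (g : ↥(graphAut G)) (κ : Col G m), g • κ = κ → g = 1

/-- The set of proper colourings of `G` with colour-class sizes prescribed by the integer
composition `α`. -/
def ColC {V : Type} (G : SimpleGraph V) (α : List ℕ) : Type :=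
  {κ : V → Fin α.length // (∀ u v : V, G.Adj u v → κ u ≠ κ v) ∧
    ∀ i : Fin α.length, Nat.card {v : V // κ v = i} = α.get i}

/-- The action of `graphAut G` on `α`-colourings. -/
instance {V : Type} (G : SimpleGraph V) (α : List ℕ) :
    MulAction ↥(graphAut G) (ColC G α) where
  smul g κ := ⟨fun v => κ.1 (((g⁻¹ : ↥(graphAut G)) : Equiv.Perm V) v),
    fun u v huv => κ.2.1 _ _ ((graphAut.adj_iff g⁻¹ u v).mpr huv),
    fun i => by
      rw [← κ.2.2 i]
      exact Nat.card_congr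
        (Equiv.subtypeEquiv (((g⁻¹ : ↥(graphAut G)) : Equiv.Perm V) : V ≃ V)
          (fun a => Iff.rfl))⟩
  one_smul κ := Subtype.ext (funext fun v => by
    show κ.1 (((1 : ↥(graphAut G))⁻¹ : Equiv.Perm V) v) = κ.1 v
    simp)
  mul_smul g h κ := Subtype.ext (funext fun v => by
    show κ.1 ((((g * h)⁻¹ : ↥(graphAut G)) : Equiv.Perm V) v) =
      κ.1 ((h⁻¹ : ↥(graphAut G)).1 ((g⁻¹ : ↥(graphAut G)).1 v))
    simp [mul_inv_rev])

theorem trivial_of_all_irreducible {H : Type} [Group H] [Finite H] (k : H)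
    (h : ∀ (A : Type) [AddCommGroup A] [Module ℂ A] [FiniteDimensional ℂ A]
      (γ : Representation ℂ H A), IsIrreducibleRep γ → ∀ a, γ k a = a) : k = 1 := by
  have : NeZero (Nat.card H : ℂ) := ⟨by exact_mod_cast Nat.card_pos.ne'⟩
  have : Module.Finite ℂ (MonoidAlgebra ℂ H) :=
    Module.Finite.equiv (MonoidAlgebra.coeffLinearEquiv (M := H) ℂ).symm
  have key : ∀ S : Submodule (MonoidAlgebra ℂ H) (MonoidAlgebra ℂ H),
      IsSimpleModule (MonoidAlgebra ℂ H) S →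
      ∀ s ∈ S, MonoidAlgebra.single k (1 : ℂ) * s = s := by
    intro S hS s hs
    have : FiniteDimensional ℂ S :=
      inferInstanceAs (FiniteDimensional ℂ (S.restrictScalars ℂ))
    have hap : ∀ (g : H) (x : S), (Representation.ofModule' (k := ℂ) (G := H) S) g x =
        MonoidAlgebra.single g (1 : ℂ) • x := fun g x => by
      simp [Representation.ofModule', MonoidAlgebra.lift]
    have := h S (Representation.ofModule' (k := ℂ) (G := H) S) ?_ ⟨s, hs⟩
    · rw [hap] at this
      exact congrArg Subtype.val this
    · refine ⟨?_, ?_⟩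
      · have := IsSimpleModule.nontrivial (MonoidAlgebra ℂ H) S
        exact exists_ne 0
      · intro p hp
        let q : Submodule (MonoidAlgebra ℂ H) S :=
          { carrier := p
            add_mem' := p.add_mem
            zero_mem' := p.zero_mem
            smul_mem' := by
              intro c x hx
              induction c using MonoidAlgebra.induction_on with
              | of g => have := hp g x hx; rw [hap] at this; exact this
              | add a b ha hb => rw [add_smul]; exact p.add_mem ha hb
              | smul r f hf => rw [smul_assoc]; exact p.smul_mem r hf }
        rcases eq_bot_or_eq_top q with hq | hq
        · left
          ext x
          have : x ∈ p ↔ x ∈ (⊥ : Submodule (MonoidAlgebra ℂ H) S) := by rw [← hq]; rfl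
          simpa using this
        · right
          ext x
          have : x ∈ p ↔ x ∈ (⊤ : Submodule (MonoidAlgebra ℂ H) S) := by rw [← hq]; rfl
          simpa using this
  have h1 : (1 : MonoidAlgebra ℂ H) ∈
      sSup {m : Submodule (MonoidAlgebra ℂ H) (MonoidAlgebra ℂ H) |
        IsSimpleModule (MonoidAlgebra ℂ H) m} := by
    rw [IsSemisimpleModule.sSup_simples_eq_top]; trivial
  rw [sSup_eq_iSup'] at h1
  have h2 : MonoidAlgebra.single k (1 : ℂ) * 1 = 1 := by
    refine Submodule.iSup_induction _ (motive := fun x => MonoidAlgebra.single k (1 : ℂ) * x = x)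
      h1 (fun S x hx => key S.1 S.2 x hx) (by simp) ?_
    intro x y hx hy
    rw [mul_add, hx, hy]
  rw [mul_one, MonoidAlgebra.one_def] at h2
  exact MonoidAlgebra.single_left_injective one_ne_zero h2

section RepMap

variable {H S A : Type} [Group H] [MulAction H S] [AddCommGroup A] [Module ℂ A]
  (γ : Representation ℂ H A)

/-- Evaluation of equivariant maps at orbit representatives. -/
noncomputable def evalRep :
    ↥(repHom (Representation.ofMulAction ℂ H S) γ) →ₗ[ℂ]
      (MulAction.orbitRel.Quotient H S → A) where
  toFun T := fun q => T.1 (MonoidAlgebra.single q.out 1)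
  map_add' T U := by ext q; simp
  map_smul' c T := by ext q; simp

theorem evalRep_injective : Function.Injective (evalRep (S := S) γ) := by
  intro T U hTU
  apply Subtype.ext
  have hs : ∀ s : S, T.1 (MonoidAlgebra.single s 1) = U.1 (MonoidAlgebra.single s 1) := by
    intro s
    let q : MulAction.orbitRel.Quotient H S := Quotient.mk _ s
    have hq : (MulAction.orbitRel H S) q.out s := Quotient.mk_out s
    rw [MulAction.orbitRel_apply] at hq
    obtain ⟨g, hg⟩ := hq
    have hg' : s = g⁻¹ • q.out := by rw [← hg]; simp
    have e : T.1 (MonoidAlgebra.single q.out 1) = U.1 (MonoidAlgebra.single q.out 1) :=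
      congrFun hTU q
    have hT := T.2 g⁻¹ (MonoidAlgebra.single q.out 1)
    have hU := U.2 g⁻¹ (MonoidAlgebra.single q.out 1)
    rw [Representation.ofMulAction_single, ← hg'] at hT hU
    rw [hT, hU, e]
  refine LinearMap.ext fun x => ?_
  induction x using MonoidAlgebra.induction_linear with
  | zero => simp
  | add f g hf hg => rw [map_add, map_add, hf, hg]
  | single s r =>
    have : MonoidAlgebra.single s r = r • (MonoidAlgebra.single s (1 : ℂ)) := by simp
    rw [this, map_smul, map_smul, hs]

theorem evalRep_surjective (hfree : ∀ (g : H) (s : S), g • s = s → g = 1) :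
    Function.Surjective (evalRep (S := S) γ) := by
  intro f
  have hex : ∀ s : S, ∃ g : H, g • (Quotient.mk (MulAction.orbitRel H S) s).out = s := by
    intro s
    have hq : (MulAction.orbitRel H S) (Quotient.mk (MulAction.orbitRel H S) s).out s :=
      Quotient.mk_out s
    rw [MulAction.orbitRel_apply] at hq
    obtain ⟨g, hg⟩ := hq
    exact ⟨g⁻¹, by rw [← hg]; simp⟩
  choose c hc using hex
  have cuniq : ∀ (s : S) (g : H), g • (Quotient.mk (MulAction.orbitRel H S) s).out = s →
      g = c s := by
    intro s g hg
    have : ((c s)⁻¹ * g) • (Quotient.mk (MulAction.orbitRel H S) s).out =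
        (Quotient.mk (MulAction.orbitRel H S) s).out := by
      rw [mul_smul, hg, inv_smul_eq_iff, hc]
    have := hfree _ _ this
    exact (inv_mul_eq_one.mp this).symm
  have hmk : ∀ (g : H) (s : S), Quotient.mk (MulAction.orbitRel H S) (g • s) =
      Quotient.mk (MulAction.orbitRel H S) s := fun g s =>
    Quotient.sound (by
      show (MulAction.orbitRel H S) _ _
      rw [MulAction.orbitRel_apply]; exact ⟨g, rfl⟩)
  have hcg : ∀ (g : H) (s : S), c (g • s) = g * c s := by
    intro g s
    symm
    apply cuniq
    rw [hmk, mul_smul, hc]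
  let φ : S → A := fun s => γ (c s) (f (Quotient.mk _ s))
  let T : MonoidAlgebra ℂ S →ₗ[ℂ] A :=
    (Finsupp.linearCombination ℂ φ) ∘ₗ (MonoidAlgebra.coeffLinearEquiv (M := S) ℂ).toLinearMap
  have hT : ∀ s r, T (MonoidAlgebra.single s r) = r • φ s := by
    intro s r
    simp [T]
  refine ⟨⟨T, ?_⟩, ?_⟩
  · intro g x
    induction x using MonoidAlgebra.induction_linear with
    | zero => simp
    | add f g hf hg => simp only [map_add, hf, hg]
    | single s r =>
      rw [Representation.ofMulAction_single, hT, hT, map_smul]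
      simp only [φ]
      rw [hcg, hmk, map_mul]
      rfl
  · funext q
    show T (MonoidAlgebra.single q.out 1) = f q
    have hq : Quotient.mk (MulAction.orbitRel H S) q.out = q := Quotient.out_eq q
    have h1 : c q.out = 1 := by
      symm
      apply cuniq
      rw [one_smul, hq]
    rw [hT, one_smul]
    simp only [φ]
    rw [h1, hq, map_one]
    rfl

theorem fix_of_evalRep_surjective (hs : Function.Surjective (evalRep (S := S) γ))
    (g : H) (s : S) (hg : g • s = s) (a : A) : γ g a = a := by
  have hq : (MulAction.orbitRel H S) (Quotient.mk (MulAction.orbitRel H S) s).out s :=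
      Quotient.mk_out s
  rw [MulAction.orbitRel_apply] at hq
  obtain ⟨h, hh⟩ := hq
  obtain ⟨T, hT⟩ := hs (fun _ => γ h a)
  have e : T.1 (MonoidAlgebra.single (Quotient.mk (MulAction.orbitRel H S) s).out 1) = γ h a :=
    congrFun hT (Quotient.mk _ s)
  have hh' : h • s = (Quotient.mk (MulAction.orbitRel H S) s).out := hh
  have e1 : T.1 (MonoidAlgebra.single s 1) = a := by
    have := T.2 h (MonoidAlgebra.single s 1)
    rw [Representation.ofMulAction_single, hh', e] at this
    have h3 := congrArg (γ h⁻¹) this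
    simpa using h3.symm
  have := T.2 g (MonoidAlgebra.single s 1)
  rw [Representation.ofMulAction_single, hg, e1] at this
  exact this.symm

end RepMap

instance instFiniteColC {V : Type} [Finite V] (G : SimpleGraph V) (α : List ℕ) :
    Finite (ColC G α) :=
  inferInstanceAs (Finite {κ : V → Fin α.length // (∀ u v : V, G.Adj u v → κ u ≠ κ v) ∧
    ∀ i : Fin α.length, Nat.card {v : V // κ v = i} = α.get i})

theorem exists_composition {V : Type} [Fintype V] (G : SimpleGraph V) (m : ℕ)
    (g : ↥(graphAut G)) (κ : Col G m) (hg : g • κ = κ) :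
    ∃ α : List ℕ, (∀ a ∈ α, 0 < a) ∧ α.sum = Fintype.card V ∧
      ∃ κ' : ColC G α, g • κ' = κ' := by
  classical
  obtain ⟨l, ⟨e⟩⟩ := Finite.exists_equiv_fin (Set.range κ.1)
  let κ₀ : V → Fin l := fun v => e ⟨κ.1 v, v, rfl⟩
  have hκ₀ : ∀ u v, κ₀ u = κ₀ v ↔ κ.1 u = κ.1 v := by
    intro u v
    exact e.injective.eq_iff.trans Subtype.mk_eq_mk
  let α : List ℕ := List.ofFn (fun i : Fin l => Nat.card {v : V // κ₀ v = i})
  have hl : α.length = l := List.length_ofFn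
  refine ⟨α, ?_, ?_, ⟨fun v => Fin.cast hl.symm (κ₀ v), ?_, ?_⟩, ?_⟩
  · intro a ha
    rw [List.mem_ofFn] at ha
    obtain ⟨i, rfl⟩ := ha
    obtain ⟨⟨_, v, rfl⟩, hv⟩ := e.surjective i
    have : Nonempty {v : V // κ₀ v = i} := ⟨⟨v, hv⟩⟩
    exact Nat.card_pos
  · rw [List.sum_ofFn, ← Nat.card_eq_fintype_card, ← Nat.card_congr (Equiv.sigmaFiberEquiv κ₀),
      Nat.card_sigma]
  · intro u v huv h
    exact κ.2 u v huv ((hκ₀ u v).mp (Fin.cast_injective _ h))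
  · intro i
    rw [List.get_ofFn]
    refine Nat.card_congr (Equiv.subtypeEquivRight fun v => ?_)
    simp [Fin.ext_iff]
  · apply Subtype.ext
    funext v
    have h1 : κ.1 (((g⁻¹ : ↥(graphAut G)) : Equiv.Perm V) v) = κ.1 v :=
      congrFun (congrArg Subtype.val hg) v
    exact congrArg (Fin.cast hl.symm) ((hκ₀ _ _).mpr h1)

/-- the action of `Aut Γ` on the proper colourings of `Γ` is free iff for every
integer composition `α` of `card V` and every irreducible finite-dimensional complex
representation `γ` of `Aut Γ`, `dim Hom(ℂ[Col_{Γ,α}], γ) = (dim γ) * #(orbits)`. -/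
theorem statement11 {V : Type} [Fintype V] (G : SimpleGraph V) :
    FreeColAction G ↔
      ∀ α : List ℕ, (∀ a ∈ α, 0 < a) → α.sum = Fintype.card V →
        ∀ (A : Type) [AddCommGroup A] [Module ℂ A] [FiniteDimensional ℂ A]
          (γ : Representation ℂ ↥(graphAut G) A), IsIrreducibleRep γ →
          homDim (Representation.ofMulAction ℂ ↥(graphAut G) (ColC G α)) γ =
            Module.finrank ℂ A *
              Nat.card (MulAction.orbitRel.Quotient ↥(graphAut G) (ColC G α)) := by
  constructor
  · intro hfree α _ _ A _ _ _ γ _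
    have hf : ∀ (g : ↥(graphAut G)) (s : ColC G α), g • s = s → g = 1 := by
      intro g s h
      refine hfree α.length g ⟨s.1, s.2.1⟩ ?_
      apply Subtype.ext
      have h' : (g • s).1 = s.1 := congrArg (fun t : ColC G α => t.1) h
      exact h'
    let e := LinearEquiv.ofBijective (evalRep (S := ColC G α) γ)
      ⟨evalRep_injective γ, evalRep_surjective γ hf⟩
    have := Fintype.ofFinite (MulAction.orbitRel.Quotient ↥(graphAut G) (ColC G α))
    rw [homDim, e.finrank_eq, Module.finrank_pi_fintype]
    simp [mul_comm]
  · intro h m g κ hg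
    obtain ⟨α, hpos, hsum, κ', hκ'⟩ := exists_composition G m g κ hg
    apply trivial_of_all_irreducible
    intro A _ _ _ γ hγ a
    refine fix_of_evalRep_surjective γ ?_ g κ' hκ' a
    have hd := h α hpos hsum A γ hγ
    have := Fintype.ofFinite (MulAction.orbitRel.Quotient ↥(graphAut G) (ColC G α))
    have hfin : FiniteDimensional ℂ
        ↥(repHom (Representation.ofMulAction ℂ ↥(graphAut G) (ColC G α)) γ) :=
      Module.Finite.of_injective _ (evalRep_injective (S := ColC G α) γ)
    refine (LinearMap.injective_iff_surjective_of_finrank_eq_finrank ?_).mp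
      (evalRep_injective (S := ColC G α) γ)
    rw [homDim] at hd
    rw [hd, Module.finrank_pi_fintype]
    simp [mul_comm]
end

section
/- The action of Aut Γ on the proper colourings of Γ is free if and only if for every m : ℕ and every irreducible finite-dimensional ℂ-linear representation γ of Aut Γ, the dimension of Hom_{Aut Γ}(ℂ[Col_{Γ,m}], γ) equals the dimension of γ multiplied by the number of orbits of Aut Γ on Col_{Γ,m}. -/
section Helpers

/-- Evaluation at orbit representatives. -/
noncomputable def evOrb {H X A : Type} [Group H] [MulAction H X] [AddCommGroup A] [Module ℂ A]
    (γ : Representation ℂ H A) :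
    ↥(repHom (Representation.ofMulAction ℂ H X) γ) →ₗ[ℂ]
      (MulAction.orbitRel.Quotient H X → A) where
  toFun T q := T.1 (MonoidAlgebra.single q.out 1)
  map_add' T S := by ext q; simp
  map_smul' c T := by ext q; simp

lemma exists_smul_out {H X : Type} [Group H] [MulAction H X] (x : X) :
    ∃ h : H, h • (Quotient.out (s := MulAction.orbitRel H X)
      (Quotient.mk (MulAction.orbitRel H X) x)) = x := by
  have h : (MulAction.orbitRel H X) x (Quotient.out (s := MulAction.orbitRel H X)
      (Quotient.mk (MulAction.orbitRel H X) x)) :=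
    (MulAction.orbitRel H X).symm (Quotient.mk_out (s := MulAction.orbitRel H X) x)
  rw [MulAction.orbitRel_apply, MulAction.mem_orbit_iff] at h
  exact h

lemma repHom_single {H X A : Type} [Group H] [MulAction H X] [AddCommGroup A] [Module ℂ A]
    (γ : Representation ℂ H A) (T : ↥(repHom (Representation.ofMulAction ℂ H X) γ))
    (g : H) (x : X) :
    T.1 (MonoidAlgebra.single (g • x) 1) = γ g (T.1 (MonoidAlgebra.single x 1)) := by
  have h := T.2 g (MonoidAlgebra.single x 1)
  rwa [Representation.ofMulAction_single] at h

lemma evOrb_injective {H X A : Type} [Group H] [MulAction H X] [AddCommGroup A] [Module ℂ A]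
    (γ : Representation ℂ H A) : Function.Injective (evOrb (X := X) γ) := by
  intro T S hTS
  apply Subtype.ext
  apply MonoidAlgebra.lhom_ext'
  intro x
  apply LinearMap.ext_ring
  obtain ⟨h, hh⟩ := exists_smul_out (H := H) x
  have h1 := congrFun hTS (Quotient.mk (MulAction.orbitRel H X) x)
  change T.1 (MonoidAlgebra.single _ 1) = S.1 (MonoidAlgebra.single _ 1) at h1
  change T.1 (MonoidAlgebra.single x 1) = S.1 (MonoidAlgebra.single x 1)
  rw [← hh, repHom_single, repHom_single, h1]

lemma evOrb_surjective {H X A : Type} [Group H] [MulAction H X] [AddCommGroup A] [Module ℂ A]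
    (γ : Representation ℂ H A) (hfree : ∀ (g : H) (x : X), g • x = x → g = 1) :
    Function.Surjective (evOrb (X := X) γ) := by
  intro f
  choose h hh using exists_smul_out (H := H) (X := X)
  have hinj : ∀ (a b : H) (x : X), a • x = b • x → a = b := by
    intro a b x hab
    have : b⁻¹ * a = 1 := hfree _ x (by rw [mul_smul, hab, inv_smul_smul])
    exact (inv_mul_eq_one.mp this).symm
  let T : MonoidAlgebra ℂ X →ₗ[ℂ] A :=
    Finsupp.linearCombination ℂ (fun x => γ (h x) (f (Quotient.mk (MulAction.orbitRel H X) x))) ∘ₗ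
      (MonoidAlgebra.coeffLinearEquiv ℂ).toLinearMap
  have hT : ∀ x, T (MonoidAlgebra.single x 1) =
      γ (h x) (f (Quotient.mk (MulAction.orbitRel H X) x)) := by
    intro x; simp [T]
  have hq : ∀ (g : H) (x : X), Quotient.mk (MulAction.orbitRel H X) (g • x) =
      Quotient.mk (MulAction.orbitRel H X) x := by
    intro g x
    exact Quotient.sound (MulAction.mem_orbit x g)
  have hmem : T ∈ repHom (Representation.ofMulAction ℂ H X) γ := by
    intro g a
    suffices hs : T ∘ₗ (Representation.ofMulAction ℂ H X g) = (γ g) ∘ₗ T from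
      LinearMap.congr_fun hs a
    apply MonoidAlgebra.lhom_ext'
    intro x
    apply LinearMap.ext_ring
    change T (Representation.ofMulAction ℂ H X g (MonoidAlgebra.single x 1)) =
      γ g (T (MonoidAlgebra.single x 1))
    rw [Representation.ofMulAction_single, hT, hT, hq]
    have : h (g • x) = g * h x := by
      apply hinj _ _ (Quotient.out (s := MulAction.orbitRel H X)
        (Quotient.mk (MulAction.orbitRel H X) x))
      have h1 := hh (g • x)
      rw [hq] at h1
      rw [h1, mul_smul, hh]
    rw [this, map_mul]
    rfl
  refine ⟨⟨T, hmem⟩, ?_⟩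
  funext q
  change T (MonoidAlgebra.single q.out 1) = f q
  have hqo : Quotient.mk (MulAction.orbitRel H X) q.out = q := Quotient.out_eq q
  have h1 := hh q.out
  rw [hqo] at h1
  rw [hT, hfree _ _ h1, hqo]
  simp

/-- The representation on a submodule of the group algebra. -/
noncomputable def subRep {H : Type} [Group H]
    (S : Submodule (MonoidAlgebra ℂ H) (MonoidAlgebra ℂ H)) :
    Representation ℂ H ↥S where
  toFun g :=
    { toFun := fun x => MonoidAlgebra.single g (1 : ℂ) • x
      map_add' := fun x y => smul_add _ x y
      map_smul' := fun c x => by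
        apply Subtype.ext
        simp }
  map_one' := by
    ext x : 1
    change MonoidAlgebra.single (1 : H) (1 : ℂ) • x = x
    rw [← MonoidAlgebra.one_def, one_smul]
  map_mul' a b := by
    ext x : 1
    change MonoidAlgebra.single (a * b) (1 : ℂ) • x =
      MonoidAlgebra.single a (1 : ℂ) • (MonoidAlgebra.single b (1 : ℂ) • x)
    rw [smul_smul, MonoidAlgebra.single_mul_single, one_mul]

lemma subRep_irr {H : Type} [Group H]
    (S : Submodule (MonoidAlgebra ℂ H) (MonoidAlgebra ℂ H))
    [IsSimpleModule (MonoidAlgebra ℂ H) S] : IsIrreducibleRep (subRep S) := by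
  refine ⟨?_, ?_⟩
  · have := IsSimpleModule.nontrivial (MonoidAlgebra ℂ H) S
    exact exists_ne 0
  · intro p hp
    have hsm : ∀ (c : MonoidAlgebra ℂ H) (x : ↥S), x ∈ p → c • x ∈ p := by
      intro c x hx
      induction c using MonoidAlgebra.induction_linear with
      | zero => rw [zero_smul]; exact p.zero_mem
      | add a b ha hb => rw [add_smul]; exact p.add_mem ha hb
      | single g r =>
        have h1 : MonoidAlgebra.single g r • x = r • (subRep S g x) := by
          change _ = r • (MonoidAlgebra.single g (1 : ℂ) • x)
          rw [← smul_assoc, MonoidAlgebra.smul_single, smul_eq_mul, mul_one]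
        rw [h1]
        exact p.smul_mem _ (hp g x hx)
    let p' : Submodule (MonoidAlgebra ℂ H) ↥S :=
      { p.toAddSubmonoid with smul_mem' := fun c x hx => hsm c x hx }
    rcases eq_bot_or_eq_top p' with h | h
    · left
      rw [eq_bot_iff]
      intro x hx
      have : x ∈ p' := hx
      rw [h] at this
      exact this
    · right
      rw [eq_top_iff]
      intro x _
      have : x ∈ p' := by rw [h]; trivial
      exact this

lemma eq_one_of_irr {H : Type} [Group H] [Finite H] (g : H)
    (hg : ∀ (A : Type) [AddCommGroup A] [Module ℂ A] [FiniteDimensional ℂ A]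
      (γ : Representation ℂ H A), IsIrreducibleRep γ → γ g = 1) : g = 1 := by
  have := Fintype.ofFinite H
  have : NeZero (Nat.card H : ℂ) := ⟨Nat.cast_ne_zero.mpr Nat.card_pos.ne'⟩
  have htop := IsSemisimpleModule.sSup_simples_eq_top (MonoidAlgebra ℂ H) (MonoidAlgebra ℂ H)
  have hfin : FiniteDimensional ℂ (MonoidAlgebra ℂ H) := inferInstance
  have key : ∀ x : MonoidAlgebra ℂ H, MonoidAlgebra.single g (1 : ℂ) * x = x := by
    intro x
    have hx : x ∈ sSup {m : Submodule (MonoidAlgebra ℂ H) (MonoidAlgebra ℂ H) |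
        IsSimpleModule (MonoidAlgebra ℂ H) m} := by rw [htop]; trivial
    rw [sSup_eq_iSup'] at hx
    induction hx using Submodule.iSup_induction' with
    | mem S y hy =>
      have := S.2
      have hS : IsSimpleModule (MonoidAlgebra ℂ H) S.1 := S.2
      have hf : FiniteDimensional ℂ ↥S.1 :=
        inferInstanceAs (FiniteDimensional ℂ ↥(S.1.restrictScalars ℂ))
      have h1 := hg ↥S.1 (subRep S.1) (subRep_irr S.1)
      have h2 := LinearMap.congr_fun h1 ⟨y, hy⟩
      exact congrArg Subtype.val h2
    | zero => rw [mul_zero]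
    | add a b _ _ ha hb => rw [mul_add, ha, hb]
  have h1 := key 1
  rw [mul_one, MonoidAlgebra.one_def] at h1
  exact MonoidAlgebra.single_left_injective one_ne_zero h1

lemma finrank_target {H X A : Type} [Group H] [MulAction H X] [Finite X]
    [AddCommGroup A] [Module ℂ A] [FiniteDimensional ℂ A] :
    Module.finrank ℂ (MulAction.orbitRel.Quotient H X → A) =
      Module.finrank ℂ A * Nat.card (MulAction.orbitRel.Quotient H X) := by
  have : Finite (MulAction.orbitRel.Quotient H X) := Quotient.finite _
  have := Fintype.ofFinite (MulAction.orbitRel.Quotient H X)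
  rw [Module.finrank_pi_fintype, Finset.sum_const, Finset.card_univ, Nat.card_eq_fintype_card,
    smul_eq_mul, mul_comm]

end Helpers

/-- the action of `Aut Γ` on the proper colourings of `Γ` is free iff for every
`m` and every irreducible finite-dimensional complex representation `γ` of `Aut Γ`,
`dim Hom(ℂ[Col_{Γ,m}], γ) = (dim γ) * #(orbits)`. -/
theorem statement12 {V : Type} [Fintype V] (G : SimpleGraph V) :
    FreeColAction G ↔
      ∀ m : ℕ,
        ∀ (A : Type) [AddCommGroup A] [Module ℂ A] [FiniteDimensional ℂ A]
          (γ : Representation ℂ ↥(graphAut G) A), IsIrreducibleRep γ →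
          homDim (Representation.ofMulAction ℂ ↥(graphAut G) (Col G m)) γ =
            Module.finrank ℂ A *
              Nat.card (MulAction.orbitRel.Quotient ↥(graphAut G) (Col G m)) := by
  
  have hcol : ∀ m, Finite (Col G m) := fun m => by unfold Col; infer_instance
  have hH : Finite ↥(graphAut G) := inferInstance
  constructor
  · intro hfree m A _ _ _ γ _
    rw [← finrank_target]
    exact (LinearEquiv.ofBijective (evOrb γ)
      ⟨evOrb_injective γ, evOrb_surjective γ (fun g x => hfree m g x)⟩).finrank_eq
  · intro hdim m g κ hgκ
    obtain ⟨h, hh⟩ := exists_smul_out (H := ↥(graphAut G)) κ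
    set κ₀ := Quotient.out (s := MulAction.orbitRel ↥(graphAut G) (Col G m))
      (Quotient.mk (MulAction.orbitRel ↥(graphAut G) (Col G m)) κ) with hκ₀
    have hfix : (h⁻¹ * g * h) • κ₀ = κ₀ := by
      rw [mul_smul, mul_smul, hh, hgκ, inv_smul_eq_iff, hh]
    have hone : h⁻¹ * g * h = 1 := by
      apply eq_one_of_irr
      intro A _ _ _ γ hγ
      have hd := hdim m A γ hγ
      rw [← finrank_target] at hd
      have hQ : Finite (MulAction.orbitRel.Quotient ↥(graphAut G) (Col G m)) :=
        Quotient.finite _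
      have hfd : FiniteDimensional ℂ
          ↥(repHom (Representation.ofMulAction ℂ ↥(graphAut G) (Col G m)) γ) :=
        FiniteDimensional.of_injective (evOrb γ) (evOrb_injective γ)
      have hsurj : Function.Surjective (evOrb (X := Col G m) γ) :=
        (LinearMap.injective_iff_surjective_of_finrank_eq_finrank hd).mp (evOrb_injective γ)
      ext a
      obtain ⟨T, hT⟩ := hsurj (fun _ => a)
      have h1 := congrFun hT (Quotient.mk (MulAction.orbitRel ↥(graphAut G) (Col G m)) κ)
      change T.1 (MonoidAlgebra.single κ₀ 1) = a at h1
      have h2 := repHom_single γ T (h⁻¹ * g * h) κ₀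
      rw [hfix, h1] at h2
      exact h2.symm
    have : g = h * (h⁻¹ * g * h) * h⁻¹ := by group
    rw [this, hone]
    group
end

section
/- For every finite-dimensional ℂ-linear representation γ of Aut Γ there exists a polynomial p with rational coefficients such that for every m : ℕ, p(m) = dim Hom_{Aut Γ}(ℂ[Col_{Γ,m}], γ); that is, the intertwining number χ_{Γ,γ}(m) = dim Hom_{Aut Γ}(ℂ[Col_{Γ,m}], γ) is a polynomial function of the number of colours m. -/
/-- Equivariant functions on colourings supported on the proper surjective ones. -/
def surFun {V : Type} (G : SimpleGraph V) {A : Type} [AddCommGroup A] [Module ℂ A]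
    (γ : Representation ℂ ↥(graphAut G) A) (I : Type) : Submodule ℂ ((V → I) → A) where
  carrier := {f | (∀ (g : ↥(graphAut G)) (κ : V → I),
      f (fun v => κ ((g⁻¹ : ↥(graphAut G)).1 v)) = γ g (f κ)) ∧
    (∀ κ : V → I, ¬ (∀ u v : V, G.Adj u v → κ u ≠ κ v) → f κ = 0) ∧
    (∀ κ : V → I, ¬ Function.Surjective κ → f κ = 0)}
  add_mem' := by
    rintro a b ⟨h1, h2, h3⟩ ⟨k1, k2, k3⟩
    refine ⟨fun g κ => ?_, fun κ h => ?_, fun κ h => ?_⟩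
    · simp only [Pi.add_apply, h1, k1, map_add]
    · simp only [Pi.add_apply, h2 κ h, k2 κ h, add_zero]
    · simp only [Pi.add_apply, h3 κ h, k3 κ h, add_zero]
  zero_mem' := by
    refine ⟨fun g κ => ?_, fun κ h => ?_, fun κ h => ?_⟩ <;> simp
  smul_mem' := by
    rintro c a ⟨h1, h2, h3⟩
    refine ⟨fun g κ => ?_, fun κ h => ?_, fun κ h => ?_⟩
    · simp only [Pi.smul_apply, h1, map_smul]
    · simp only [Pi.smul_apply, h2 κ h, smul_zero]
    · simp only [Pi.smul_apply, h3 κ h, smul_zero]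

/-- Transport along a bijection of colours. -/
def surFunMap {V : Type} (G : SimpleGraph V) {A : Type} [AddCommGroup A] [Module ℂ A]
    (γ : Representation ℂ ↥(graphAut G) A) {I J : Type} (e : I ≃ J) :
    surFun G γ I ≃ₗ[ℂ] surFun G γ J where
  toFun f := ⟨fun κ => f.1 (fun v => e.symm (κ v)), by
    obtain ⟨f, h1, h2, h3⟩ := f
    refine ⟨fun g κ => h1 g (fun v => e.symm (κ v)), fun κ h => h2 _ ?_, fun κ h => h3 _ ?_⟩
    · simpa using h
    · intro hs
      exact h ((e.symm.comp_surjective κ).mp hs)⟩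
  invFun f := ⟨fun κ => f.1 (fun v => e (κ v)), by
    obtain ⟨f, h1, h2, h3⟩ := f
    refine ⟨fun g κ => h1 g (fun v => e (κ v)), fun κ h => h2 _ ?_, fun κ h => h3 _ ?_⟩
    · simpa using h
    · intro hs
      exact h ((e.comp_surjective κ).mp hs)⟩
  map_add' _ _ := rfl
  map_smul' _ _ := rfl
  left_inv f := by ext κ; simp
  right_inv f := by ext κ; simp

/-- Equivariant functions on the proper colourings. -/
def colFun {V : Type} (G : SimpleGraph V) {A : Type} [AddCommGroup A] [Module ℂ A]
    (γ : Representation ℂ ↥(graphAut G) A) (m : ℕ) : Submodule ℂ (Col G m → A) where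
  carrier := {f | ∀ (g : ↥(graphAut G)) (κ : Col G m), f (g • κ) = γ g (f κ)}
  add_mem' := by
    intro a b h k g κ
    simp only [Pi.add_apply, h g κ, k g κ, map_add]
  zero_mem' := by intro g κ; simp
  smul_mem' := by
    intro c a h g κ
    simp only [Pi.smul_apply, h g κ, map_smul]

/-- Equivariant maps out of the permutation representation are equivariant functions. -/
noncomputable def repHomEquiv {V : Type} (G : SimpleGraph V)
    {A : Type} [AddCommGroup A] [Module ℂ A]
    (γ : Representation ℂ ↥(graphAut G) A) (m : ℕ) :
    repHom (Representation.ofMulAction ℂ ↥(graphAut G) (Col G m)) γ ≃ₗ[ℂ] colFun G γ m where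
  toFun T := ⟨fun κ => T.1 (MonoidAlgebra.single κ 1), by
    intro g κ
    have := T.2 g (MonoidAlgebra.single κ 1)
    rw [Representation.ofMulAction_single] at this
    exact this⟩
  invFun f := ⟨(Finsupp.lift A ℂ (Col G m) f.1) ∘ₗ
      (MonoidAlgebra.coeffLinearEquiv ℂ).toLinearMap, by
    intro g a
    have : ((Finsupp.lift A ℂ (Col G m) f.1) ∘ₗ
      (MonoidAlgebra.coeffLinearEquiv ℂ).toLinearMap) ∘ₗ
        (Representation.ofMulAction ℂ ↥(graphAut G) (Col G m) g) = γ g ∘ₗ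
        ((Finsupp.lift A ℂ (Col G m) f.1) ∘ₗ
      (MonoidAlgebra.coeffLinearEquiv ℂ).toLinearMap) := by
      ext κ
      simp [f.2 g κ]
    exact LinearMap.congr_fun this a⟩
  map_add' _ _ := rfl
  map_smul' _ _ := rfl
  left_inv T := by
    apply Subtype.ext
    ext κ
    simp
  right_inv f := by ext κ; simp

lemma surFun_congr {V : Type} (G : SimpleGraph V)
    {A : Type} [AddCommGroup A] [Module ℂ A]
    (γ : Representation ℂ ↥(graphAut G) A) {m : ℕ}
    (h : ∀ S : Finset (Fin m), surFun G γ S) {S T : Finset (Fin m)} (hST : S = T)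
    (κ : V → S) (κ' : V → T) (hk : ∀ v, (κ v).1 = (κ' v).1) :
    (h S).1 κ = (h T).1 κ' := by
  subst hST
  have : κ = κ' := funext fun v => Subtype.ext (hk v)
  rw [this]

lemma image_inv {V : Type} [Fintype V] (G : SimpleGraph V) {m : ℕ} (g : ↥(graphAut G))
    (κ : V → Fin m) :
    Finset.univ.image (fun v => κ ((g⁻¹ : ↥(graphAut G)).1 v)) = Finset.univ.image κ := by
  ext i
  simp only [Finset.mem_image, Finset.mem_univ, true_and]
  constructor
  · rintro ⟨v, hv⟩
    exact ⟨_, hv⟩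
  · rintro ⟨v, hv⟩
    exact ⟨g.1 v, by simpa using hv⟩

open Classical in
/-- Decomposition by the set of colours used. -/
noncomputable def colFunEquiv {V : Type} [Fintype V] (G : SimpleGraph V)
    {A : Type} [AddCommGroup A] [Module ℂ A]
    (γ : Representation ℂ ↥(graphAut G) A) (m : ℕ) :
    colFun G γ m ≃ₗ[ℂ] ((S : Finset (Fin m)) → surFun G γ S) where
  toFun f S := ⟨fun κ => if h : (∀ u v : V, G.Adj u v → κ u ≠ κ v) ∧ Function.Surjective κ then
      f.1 ⟨fun v => (κ v).1, fun u v huv hk => h.1 u v huv (Subtype.ext hk)⟩ else 0, by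
    refine ⟨fun g κ => ?_, fun κ h => dif_neg fun h' => h h'.1,
      fun κ h => dif_neg fun h' => h h'.2⟩
    by_cases h : (∀ u v : V, G.Adj u v → κ u ≠ κ v) ∧ Function.Surjective κ
    · have h' : (∀ u v : V, G.Adj u v → κ ((g⁻¹ : ↥(graphAut G)).1 u) ≠
          κ ((g⁻¹ : ↥(graphAut G)).1 v)) ∧
          Function.Surjective (fun v => κ ((g⁻¹ : ↥(graphAut G)).1 v)) :=
        ⟨fun u v huv => h.1 _ _ ((graphAut.adj_iff g⁻¹ u v).mpr huv),
          h.2.comp (g⁻¹ : ↥(graphAut G)).1.surjective⟩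
      refine (dif_pos h').trans ?_
      refine Eq.trans ?_ (congrArg (γ g) (dif_pos h).symm)
      exact f.2 g ⟨fun v => (κ v).1, fun u v huv hk => h.1 u v huv (Subtype.ext hk)⟩
    · have h' : ¬ ((∀ u v : V, G.Adj u v → κ ((g⁻¹ : ↥(graphAut G)).1 u) ≠
          κ ((g⁻¹ : ↥(graphAut G)).1 v)) ∧
          Function.Surjective (fun v => κ ((g⁻¹ : ↥(graphAut G)).1 v))) := by
        rintro ⟨h1, h2⟩
        refine h ⟨fun u v huv => ?_, fun i => ?_⟩
        · have := h1 (g.1 u) (g.1 v) ((graphAut.adj_iff g u v).mpr huv)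
          simpa using this
        · obtain ⟨v, hv⟩ := h2 i
          exact ⟨_, hv⟩
      refine (dif_neg h').trans ?_
      refine Eq.trans ?_ (congrArg (γ g) (dif_neg h).symm)
      exact (map_zero _).symm⟩
  invFun h := ⟨fun κ => (h (Finset.univ.image κ.1)).1
      (fun v => ⟨κ.1 v, Finset.mem_image_of_mem _ (Finset.mem_univ v)⟩), by
    intro g κ
    rw [← (h (Finset.univ.image κ.1)).2.1 g]
    exact surFun_congr G γ h (image_inv G g κ.1) _ _ (fun v => rfl)⟩
  map_add' a b := by
    funext S
    ext κ
    by_cases h : (∀ u v : V, G.Adj u v → κ u ≠ κ v) ∧ Function.Surjective κ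
    · simp [dif_pos h]
      rfl
    · simp [dif_neg h]
  map_smul' c b := by
    funext S
    ext κ
    by_cases h : (∀ u v : V, G.Adj u v → κ u ≠ κ v) ∧ Function.Surjective κ
    · simp [dif_pos h]
      rfl
    · simp [dif_neg h]
  left_inv f := by
    ext κ
    refine dif_pos (c := _ ∧ _) ⟨fun u v huv hk => κ.2 u v huv (congrArg Subtype.val hk), ?_⟩
    rintro ⟨i, hi⟩
    obtain ⟨v, -, hv⟩ := Finset.mem_image.mp hi
    exact ⟨v, Subtype.ext hv⟩
  right_inv h := by
    funext S
    ext κ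
    by_cases hk : (∀ u v : V, G.Adj u v → κ u ≠ κ v) ∧ Function.Surjective κ
    · refine (dif_pos hk).trans ?_
      refine surFun_congr G γ h ?_ _ _ (fun v => rfl)
      ext i
      simp only [Finset.mem_image, Finset.mem_univ, true_and]
      constructor
      · rintro ⟨v, rfl⟩
        exact (κ v).2
      · intro hi
        obtain ⟨v, hv⟩ := hk.2 ⟨i, hi⟩
        exact ⟨v, congrArg Subtype.val hv⟩
    · refine (dif_neg hk).trans ?_
      by_cases h1 : ∀ u v : V, G.Adj u v → κ u ≠ κ v
      · exact ((h S).2.2.2 κ fun h2 => hk ⟨h1, h2⟩).symm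
      · exact ((h S).2.2.1 κ h1).symm

lemma homDim_eq {V : Type} [Fintype V] (G : SimpleGraph V)
    (A : Type) [AddCommGroup A] [Module ℂ A] [FiniteDimensional ℂ A]
    (γ : Representation ℂ ↥(graphAut G) A) (m : ℕ) :
    homDim (Representation.ofMulAction ℂ ↥(graphAut G) (Col G m)) γ =
      ∑ k ∈ Finset.range (Fintype.card V + 1),
        m.choose k * Module.finrank ℂ (surFun G γ (Fin k)) := by
  have hz : ∀ k, Fintype.card V < k → Module.finrank ℂ (surFun G γ (Fin k)) = 0 := by
    intro k hk
    have : surFun G γ (Fin k) = ⊥ := by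
      rw [eq_bot_iff]
      intro f hf
      rw [Submodule.mem_bot]
      funext κ
      refine hf.2.2 κ fun hs => ?_
      have := Fintype.card_le_of_surjective κ hs
      simp at this
      omega
    rw [this, finrank_bot]
  classical
  unfold homDim
  rw [(repHomEquiv G γ m).finrank_eq, (colFunEquiv G γ m).finrank_eq,
    Module.finrank_pi_fintype]
  have h1 : ∀ S : Finset (Fin m), Module.finrank ℂ (surFun G γ S) =
      Module.finrank ℂ (surFun G γ (Fin S.card)) := fun S =>
    (surFunMap G γ S.equivFin).finrank_eq
  simp_rw [h1]
  rw [← Finset.powerset_univ,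
    Finset.sum_powerset_apply_card (fun k => Module.finrank ℂ (surFun G γ (Fin k)))]
  simp only [Finset.card_univ, Fintype.card_fin, smul_eq_mul]
  rw [Finset.sum_subset (Finset.range_subset_range.mpr
      (Nat.add_le_add_right (le_max_left m (Fintype.card V)) 1)),
    ← Finset.sum_subset (Finset.range_subset_range.mpr
      (Nat.add_le_add_right (le_max_right m (Fintype.card V)) 1))]
  · intro k _ hk
    rw [hz k (by simpa using hk), mul_zero]
  · intro k _ hk
    rw [Nat.choose_eq_zero_of_lt (by simpa using hk), zero_mul]

/-- for every finite-dimensional complex representation `γ` of `Aut Γ`, the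
intertwining number `χ_{Γ,γ}(m) = dim Hom(ℂ[Col_{Γ,m}], γ)` is a polynomial function
of the number of colours `m`. -/
theorem statement16 {V : Type} [Fintype V] (G : SimpleGraph V)
    (A : Type) [AddCommGroup A] [Module ℂ A] [FiniteDimensional ℂ A]
    (γ : Representation ℂ ↥(graphAut G) A) :
    ∃ p : Polynomial ℚ, ∀ m : ℕ,
      p.eval (m : ℚ) =
        (homDim (Representation.ofMulAction ℂ ↥(graphAut G) (Col G m)) γ : ℚ) := by
  refine ⟨∑ k ∈ Finset.range (Fintype.card V + 1),
    Polynomial.C ((Module.finrank ℂ (surFun G γ (Fin k)) : ℚ) / (k.factorial : ℚ)) *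
      descPochhammer ℚ k, fun m => ?_⟩
  rw [homDim_eq, Polynomial.eval_finsetSum]
  push_cast
  refine Finset.sum_congr rfl fun k _ => ?_
  rw [Polynomial.eval_mul, Polynomial.eval_C, descPochhammer_eval_eq_descFactorial,
    Nat.descFactorial_eq_factorial_mul_choose]
  have : (k.factorial : ℚ) ≠ 0 := by exact_mod_cast k.factorial_ne_zero
  push_cast
  field_simp
end
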